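/- arXiv:2305.16574 — 5 statements merged into one kernel-verified Lean document; each statement's English description precedes it below -/
import Mathlib

section
/- Let b be a contextual cyclic system of rank n ≥ 2. Then there exist a feasible signed quasi-coupling y with ∑_s |y s| = 1 + CNT3(b) whose unique negative component is at a state v with y v = −CNT3(b)/2, and a nonnegative z satisfying the CNTF constraints with ∑_s z s = 1 − CNTF(b), such that z s ≤ |y s| for every state s, z v = 0, and ∑_s |y s − z s| = n · CNT3(b). -/
open Finset

/-- Cyclic predecessor `i ⊖ 1` on `Fin n`. -/
def fpred {n : ℕ} (i : Fin n) : Fin n := ⟨(i.val + (n - 1)) % n, Nat.mod_lt _ i.pos⟩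

/-- Cyclic successor `i ⊕ 1` on `Fin n`. -/
def fsucc {n : ℕ} (i : Fin n) : Fin n := ⟨(i.val + 1) % n, Nat.mod_lt _ i.pos⟩

/-- `b` specifies a cyclic system of rank `n`: each bunch distribution is
nonnegative and sums to one. -/
def IsCyclicSystem (n : ℕ) (b : Fin n → Bool → Bool → ℝ) : Prop :=
  (∀ i r r', 0 ≤ b i r r') ∧ ∀ i, (∑ r : Bool, ∑ r' : Bool, b i r r') = 1

/-- Marginal distribution of `R_i^i`. -/
def mFst {n : ℕ} (b : Fin n → Bool → Bool → ℝ) (i : Fin n) (r : Bool) : ℝ :=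
  b i r false + b i r true

/-- Marginal distribution of `R_i^{i⊖1}`. -/
def mSnd {n : ℕ} (b : Fin n → Bool → Bool → ℝ) (i : Fin n) (r : Bool) : ℝ :=
  b (fpred i) false r + b (fpred i) true r

/-- Multimaximal-coupling distribution of connection `i`:
joint distribution of `(T_i^i, T_i^{i⊖1})`. -/
noncomputable def mmc {n : ℕ} (b : Fin n → Bool → Bool → ℝ) (i : Fin n) : Bool → Bool → ℝ :=
  fun r r' =>
    match r, r' with
    | true, true => min (mFst b i true) (mSnd b i true)
    | false, false => min (mFst b i false) (mSnd b i false)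
    | true, false => mFst b i true - min (mFst b i true) (mSnd b i true)
    | false, true => mSnd b i true - min (mFst b i true) (mSnd b i true)

/-- Bunch marginal of a signed quasi-coupling `y` at context `i`. -/
def Bm {n : ℕ} (i : Fin n) (y : (Fin n → Bool × Bool) → ℝ) (r r' : Bool) : ℝ :=
  ∑ s : Fin n → Bool × Bool, if s i = (r, r') then y s else 0

/-- Connection marginal of a signed quasi-coupling `y` at content `i`. -/
def Cm {n : ℕ} (i : Fin n) (y : (Fin n → Bool × Bool) → ℝ) (r r' : Bool) : ℝ :=
  ∑ s : Fin n → Bool × Bool, if (s i).1 = r ∧ (s (fpred i)).2 = r' then y s else 0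

/-- `y` is a feasible signed quasi-coupling for the system `b`. -/
def Feasible {n : ℕ} (b : Fin n → Bool → Bool → ℝ) (y : (Fin n → Bool × Bool) → ℝ) : Prop :=
  ∀ i r r', Bm i y r r' = b i r r' ∧ Cm i y r r' = mmc b i r r'

/-- The quasi-coupling measure of contextuality. -/
noncomputable def CNT3 {n : ℕ} (b : Fin n → Bool → Bool → ℝ) : ℝ :=
  sInf {t : ℝ | ∃ y, Feasible b y ∧ t = ∑ s : Fin n → Bool × Bool, |y s|} - 1

/-- Constraints of the contextual-fraction linear program. -/
def CNTFConstraints {n : ℕ} (b : Fin n → Bool → Bool → ℝ)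
    (z : (Fin n → Bool × Bool) → ℝ) : Prop :=
  (∀ s, 0 ≤ z s) ∧ ∀ i r r', Bm i z r r' ≤ b i r r' ∧ Cm i z r r' ≤ mmc b i r r'

/-- The contextual fraction. -/
noncomputable def CNTF {n : ℕ} (b : Fin n → Bool → Bool → ℝ) : ℝ :=
  1 - sSup {t : ℝ | ∃ z, CNTFConstraints b z ∧ t = ∑ s : Fin n → Bool × Bool, z s}

/-- `b` is noncontextual iff it admits a nonnegative feasible coupling. -/
def Noncontextual {n : ℕ} (b : Fin n → Bool → Bool → ℝ) : Prop :=
  ∃ y, Feasible b y ∧ ∀ s, 0 ≤ y s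

/-! ### Couplings along a path of binary variables -/

/-- First marginal of the `j`-th edge distribution of a family. -/
def edgeMarg (e : ℕ → Bool → Bool → ℝ) (j : ℕ) (r : Bool) : ℝ := e j r false + e j r true

/-- Consecutive edge distributions share the marginal of their common vertex and have total
mass `T`. -/
def Consistent (T : ℝ) (e : ℕ → Bool → Bool → ℝ) : Prop :=
  (∀ j r, e j false r + e j true r = edgeMarg e (j + 1) r) ∧
    ∀ j, edgeMarg e j false + edgeMarg e j true = T

/-- Three pairwise distributions with common marginals that satisfy the triangle inequalities
are the marginals of a joint distribution. -/
lemma exists_triangle_coupling (g t f : Bool → Bool → ℝ)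
    (hg : ∀ r r', 0 ≤ g r r') (ht : ∀ r r', 0 ≤ t r r') (hf : ∀ r r', 0 ≤ f r r')
    (hsum : g false false + g false true + g true false + g true true = 1)
    (hgf : ∀ r, g r false + g r true = f r false + f r true)
    (hgt : ∀ r, g false r + g true r = t r false + t r true)
    (htf : ∀ r, t false r + t true r = f false r + f true r)
    (h1 : f false true + f true false ≤
      g false true + g true false + (t false true + t true false))
    (h2 : g false true + g true false ≤
      f false true + f true false + (t false true + t true false))
    (h3 : t false true + t true false ≤
      g false true + g true false + (f false true + f true false))
    (h4 : g false true + g true false + (t false true + t true false) +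
      (f false true + f true false) ≤ 2) :
    ∃ τ : Bool → Bool → Bool → ℝ, (∀ a c d, 0 ≤ τ a c d) ∧
      (∀ a c, τ a c false + τ a c true = g a c) ∧
      (∀ c d, τ false c d + τ true c d = t c d) ∧
      ∀ a d, τ a false d + τ a true d = f a d := by
  have hgf0 := hgf false
  have hgf1 := hgf true
  have hgt0 := hgt false
  have hgt1 := hgt true
  have htf0 := htf false
  have htf1 := htf true
  have g00 := hg false false
  have g01 := hg false true
  have g10 := hg true false
  have g11 := hg true true
  have t00 := ht false false
  have t01 := ht false true
  have t10 := ht true false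
  have t11 := ht true true
  have f00 := hf false false
  have f01 := hf false true
  have f10 := hf true false
  have f11 := hf true true
  obtain ⟨x, hx⟩ : ∃ x : ℝ, (0 ≤ x ∧ g true true - f true false ≤ x ∧
      g true true - t true false ≤ x ∧ t true true - f false true ≤ x) ∧
      (x ≤ g true true ∧ x ≤ t true true ∧ x ≤ f true true ∧
        x ≤ g false false - f false true + t true true) := by
    refine ⟨max (max 0 (g true true - f true false))
      (max (g true true - t true false) (t true true - f false true)), ?_, ?_⟩
    · have a1 := le_max_left (max 0 (g true true - f true false))
        (max (g true true - t true false) (t true true - f false true))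
      have a2 := le_max_right (max 0 (g true true - f true false))
        (max (g true true - t true false) (t true true - f false true))
      simp only [max_le_iff] at a1 a2
      exact ⟨a1.1, a1.2, a2.1, a2.2⟩
    · refine ⟨?_, ?_, ?_, ?_⟩ <;> refine max_le (max_le ?_ ?_) (max_le ?_ ?_) <;> linarith
  obtain ⟨⟨l1, l2, l3, l4⟩, u1, u2, u3, u4⟩ := hx
  refine ⟨fun a c d => match a, c, d with
    | true, true, true => x
    | true, true, false => g true true - x
    | true, false, true => f true true - x
    | false, true, true => t true true - x
    | true, false, false => f true false - g true true + x
    | false, true, false => t true false - g true true + x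
    | false, false, true => f false true - t true true + x
    | false, false, false => g false false - f false true + t true true - x, ?_, ?_, ?_, ?_⟩
  · rintro (_ | _) (_ | _) (_ | _) <;> simp only <;> linarith
  · rintro (_ | _) (_ | _) <;> simp only <;> linarith
  · rintro (_ | _) (_ | _) <;> simp only <;> linarith
  · rintro (_ | _) (_ | _) <;> simp only <;> linarith

/-- Least total probability of deviating from a sign pattern along the first `k` edges, among
patterns whose endpoints agree (`false`) or differ (`true`). -/
noncomputable def pathCost (e : ℕ → Bool → Bool → ℝ) : ℕ → Bool → ℝ
  | 0, a => if a then 1 else 0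
  | k + 1, a => min (pathCost e k a + (e k false true + e k true false))
      (pathCost e k (!a) + (e k false false + e k true true))

/-- Probability that edge `j` deviates from the sign pattern `π`. -/
def edgeCost (π : ℕ → Bool) (e : ℕ → Bool → Bool → ℝ) (j : ℕ) : ℝ :=
  e j (π j) (!π (j + 1)) + e j (!π j) (π (j + 1))

lemma exists_pattern_of_pathCost_lt_one {e : ℕ → Bool → Bool → ℝ} (he : ∀ j r r', 0 ≤ e j r r')
    (k : ℕ) (a : Bool) (ha : pathCost e k a < 1) :
    ∃ π : ℕ → Bool, xor (π 0) (π k) = a ∧ ∑ j ∈ range k, edgeCost π e j = pathCost e k a := by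
  induction k generalizing a with
  | zero =>
    cases a
    · exact ⟨fun _ => false, by simp, by simp [pathCost]⟩
    · simp [pathCost] at ha
  | succ k ih =>
    have extend : ∀ a' c, pathCost e k a' + (e k false (!c) + e k true c) < 1 →
        ∃ π : ℕ → Bool, xor (π 0) (π (k + 1)) = xor a' c ∧
          ∑ j ∈ range (k + 1), edgeCost π e j = pathCost e k a' +
            (e k false (!c) + e k true c) := by
      intro a' c h
      obtain ⟨π, h0, hπ⟩ := ih a' (by linarith [he k false (!c), he k true c])
      refine ⟨fun x => if x ≤ k then π x else xor (π k) c, by simp [← h0], ?_⟩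
      rw [sum_range_succ, ← hπ]
      congr 1
      · refine sum_congr rfl fun j hj => ?_
        have hj := mem_range.1 hj
        simp [edgeCost, hj.le, Nat.succ_le_iff.2 hj]
      · cases hk : π k <;> cases c <;> simp [edgeCost, hk, add_comm]
    rw [pathCost] at ha ⊢
    rcases min_choice (pathCost e k a + (e k false true + e k true false))
      (pathCost e k (!a) + (e k false false + e k true true)) with h | h
    · rw [h] at ha ⊢
      simpa using extend a false ha
    · rw [h] at ha ⊢
      simpa using extend (!a) true ha

lemma pathCost_bounds {e : ℕ → Bool → Bool → ℝ} (he : ∀ j r r', 0 ≤ e j r r')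
    (hc : Consistent 1 e) (k : ℕ) :
    (0 ≤ pathCost e k false ∧ 1 ≤ pathCost e k false + pathCost e k true) ∧
      edgeMarg e 0 true - edgeMarg e k true ≤ pathCost e k false ∧
      edgeMarg e k true - edgeMarg e 0 true ≤ pathCost e k false ∧
      1 - edgeMarg e 0 true - edgeMarg e k true ≤ pathCost e k true ∧
      edgeMarg e 0 true + edgeMarg e k true - 1 ≤ pathCost e k true := by
  induction k with
  | zero =>
    have h1 := hc.2 0
    simp only [edgeMarg] at h1 ⊢
    have n1 := he 0 false false
    have n2 := he 0 false true
    have n3 := he 0 true false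
    have n4 := he 0 true true
    simp only [pathCost]
    refine ⟨⟨?_, ?_⟩, ?_, ?_, ?_, ?_⟩ <;> norm_num <;> linarith
  | succ k ih =>
    obtain ⟨⟨i0, i1⟩, i2, i3, i4, i5⟩ := ih
    have h1 := hc.2 k
    have h2 := hc.1 k true
    have h3 : edgeMarg e k true = e k true false + e k true true := rfl
    have h4 : edgeMarg e k false = e k false false + e k false true := rfl
    have n1 := he k false false
    have n2 := he k false true
    have n3 := he k true false
    have n4 := he k true true
    simp only [pathCost, Bool.not_false, Bool.not_true]
    refine ⟨⟨le_min ?_ ?_, ?_⟩, le_min ?_ ?_, le_min ?_ ?_, le_min ?_ ?_, le_min ?_ ?_⟩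
    case refine_3 =>
      rcases min_choice (pathCost e k false + (e k false true + e k true false))
        (pathCost e k true + (e k false false + e k true true)) with h | h <;>
      rcases min_choice (pathCost e k true + (e k false true + e k true false))
        (pathCost e k false + (e k false false + e k true true)) with h' | h' <;>
      rw [h, h'] <;> linarith
    all_goals linarith

/-- A path of consistent edge distributions can be coupled with a prescribed joint distribution
of its endpoints as soon as their probability of disagreement is within the path-cost bounds. -/
theorem exists_path_coupling {e : ℕ → Bool → Bool → ℝ} (he : ∀ j r r', 0 ≤ e j r r')
    (hc : Consistent 1 e) (k : ℕ) (f : Bool → Bool → ℝ) (hf : ∀ r r', 0 ≤ f r r')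
    (hf0 : ∀ r, f r false + f r true = edgeMarg e 0 r)
    (hfk : ∀ r, f false r + f true r = edgeMarg e k r)
    (hlow : 1 - pathCost e k true ≤ f false true + f true false)
    (hupp : f false true + f true false ≤ pathCost e k false) :
    ∃ (Ω : Type) (_ : Fintype Ω) (μ : Ω → ℝ) (X : ℕ → Ω → Bool), (∀ ω, 0 ≤ μ ω) ∧
      (∀ j < k, ∀ r r', (∑ ω, if X j ω = r ∧ X (j + 1) ω = r' then μ ω else 0) = e j r r') ∧
      ∀ r r', (∑ ω, if X 0 ω = r ∧ X k ω = r' then μ ω else 0) = f r r' := by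
  induction k generalizing f with
  | zero =>
    have h0 := hf false true
    have h1 := hf true false
    simp only [pathCost] at hupp
    norm_num at hupp
    refine ⟨Bool, inferInstance, fun r => f r r, fun _ r => r, fun r => hf r r, by simp, ?_⟩
    rintro (_ | _) (_ | _) <;> simp <;> linarith
  | succ k ih =>
    obtain ⟨⟨i0, i1⟩, i2, i3, i4, i5⟩ := pathCost_bounds he hc k
    have h1 := hc.2 k
    have h10 := hc.2 0
    have h2 := hc.1 k true
    have h2' := hc.1 k false
    have h3 : edgeMarg e k true = e k true false + e k true true := rfl
    have h4 : edgeMarg e k false = e k false false + e k false true := rfl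
    have h5 : edgeMarg e 0 true = e 0 true false + e 0 true true := rfl
    have h6 : edgeMarg e 0 false = e 0 false false + e 0 false true := rfl
    have n1 := he k false false
    have n2 := he k false true
    have n3 := he k true false
    have n4 := he k true true
    have p1 := hf false false
    have p2 := hf false true
    have p3 := hf true false
    have p4 := hf true true
    have q1 := hf0 false
    have q2 := hf0 true
    have q3 := hfk false
    have q4 := hfk true
    have n01 := he 0 false false
    have n02 := he 0 false true
    have n03 := he 0 true false
    have n04 := he 0 true true
    obtain ⟨hu1, hu2⟩ := le_min_iff.1 hupp
    have hl : 1 - (f false true + f true false) ≤ pathCost e (k + 1) true := by linarith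
    obtain ⟨hl1, hl2⟩ := le_min_iff.1 hl
    simp only [Bool.not_false, Bool.not_true] at hu2 hl2
    set t := e k false true + e k true false with ht
    have ht' : e k false false + e k true true = 1 - t := by linarith
    rw [ht'] at hu2 hl2
    set δ := f false true + f true false with hδ
    set p := edgeMarg e 0 true with hp
    set q := edgeMarg e k true with hq
    set α := pathCost e k false
    set β := pathCost e k true
    obtain ⟨d, ⟨⟨d1, d2, d3⟩, d4, d5⟩, ⟨c1, c2, c3⟩, c4, c5⟩ : ∃ d : ℝ,
        ((1 - β ≤ d ∧ p - q ≤ d ∧ q - p ≤ d) ∧ δ - t ≤ d ∧ t - δ ≤ d) ∧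
        (d ≤ α ∧ d ≤ p + q ∧ d ≤ 2 - p - q) ∧ d ≤ δ + t ∧ d ≤ 2 - t - δ := by
      refine ⟨max (max (1 - β) (max (p - q) (q - p))) (max (δ - t) (t - δ)),
        by simp only [le_max_iff, le_refl, true_or, or_true, and_self], ?_⟩
      simp only [max_le_iff]
      refine ⟨⟨?_, ?_, ?_⟩, ?_, ?_⟩ <;> refine ⟨⟨?_, ?_, ?_⟩, ?_, ?_⟩ <;> linarith
    obtain ⟨g, g00, g01, g10, g11⟩ : ∃ g : Bool → Bool → ℝ,
        g false false = (2 - p - q - d) / 2 ∧ g false true = (q - p + d) / 2 ∧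
        g true false = (p - q + d) / 2 ∧ g true true = (p + q - d) / 2 :=
      ⟨fun a c => match a, c with
        | false, false => (2 - p - q - d) / 2
        | false, true => (q - p + d) / 2
        | true, false => (p - q + d) / 2
        | true, true => (p + q - d) / 2, rfl, rfl, rfl, rfl⟩
    have hg : ∀ r r', 0 ≤ g r r' := by
      rintro (_ | _) (_ | _) <;> linarith
    obtain ⟨Ω, _, μ, X, hμ, hX, hXg⟩ := ih g hg
      (by rintro (_ | _) <;> linarith) (by rintro (_ | _) <;> linarith)
      (by linarith) (by linarith)
    obtain ⟨τ, hτ, τg, τt, τf⟩ := exists_triangle_coupling g (e k) f hg (he k) hf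
      (by linarith) (by rintro (_ | _) <;> linarith) (by rintro (_ | _) <;> linarith)
      (by rintro (_ | _) <;> linarith) (by linarith) (by linarith) (by linarith) (by linarith)
    obtain ⟨κ, hκ, κ1, κτ⟩ : ∃ κ : Bool → Bool → Bool → ℝ, (∀ a c d, 0 ≤ κ a c d) ∧
        (∀ a c, κ a c false + κ a c true = 1) ∧ ∀ a c d, g a c * κ a c d = τ a c d := by
      refine ⟨fun a c d => if g a c = 0 then 1 / 2 else τ a c d / g a c, ?_, ?_, ?_⟩
      · intro a c d
        dsimp only
        split_ifs
        · norm_num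
        · exact div_nonneg (hτ _ _ _) (hg _ _)
      · intro a c
        dsimp only
        split_ifs with h
        · norm_num
        · rw [← add_div, τg, div_self h]
      · intro a c d
        dsimp only
        split_ifs with h
        · have e1 := τg a c
          have e2 := hτ a c false
          have e3 := hτ a c true
          rw [h] at e1 ⊢
          cases d <;> linarith
        · exact mul_div_cancel₀ _ h
    refine ⟨Ω × Bool, inferInstance, fun ω => μ ω.1 * κ (X 0 ω.1) (X k ω.1) ω.2,
      fun j ω => if j ≤ k then X j ω.1 else ω.2,
      fun ω => mul_nonneg (hμ _) (hκ _ _ _), ?_, ?_⟩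
    · intro j hj r r'
      rcases Nat.lt_succ_iff_lt_or_eq.1 hj with hj | rfl
      · rw [← hX j hj, Fintype.sum_prod_type]
        refine sum_congr rfl fun ω _ => ?_
        have := κ1 (X 0 ω) (X k ω)
        simp only [hj.le, Nat.succ_le_iff.2 hj, if_true, Fintype.sum_bool]
        split_ifs
        · rw [← mul_add, add_comm, this, mul_one]
        · simp
      · rw [← τt, ← κτ, ← κτ, ← hXg, ← hXg, sum_mul, sum_mul, ← sum_add_distrib,
          Fintype.sum_prod_type]
        refine sum_congr rfl fun ω _ => ?_
        cases h : X 0 ω <;> cases h' : X j ω <;> cases r <;> cases r' <;> simp [h, h']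
    · intro r r'
      rw [← τf, ← κτ, ← κτ, ← hXg, ← hXg, sum_mul, sum_mul, ← sum_add_distrib,
          Fintype.sum_prod_type]
      refine sum_congr rfl fun ω _ => ?_
      cases h : X 0 ω <;> cases h' : X k ω <;> cases r <;> cases r' <;> simp [h, h']

/-! ### Cyclic systems as cycles of `2 * n` edges -/

/-- The variables of a joint state in cyclic order: `R_0^0, R_1^0, R_1^1, R_2^1, …`. -/
def vtx {n : ℕ} [NeZero n] (s : Fin n → Bool × Bool) (x : ℕ) : Bool :=
  if x % 2 = 0 then (s (Fin.ofNat n (x / 2))).1 else (s (Fin.ofNat n (x / 2))).2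

/-- The joint state that takes prescribed values along the cyclic order. -/
def ofVtx (n : ℕ) (t : ℕ → Bool) : Fin n → Bool × Bool := fun i => (t (2 * i), t (2 * i + 1))

/-- Distributions of the edges of the cycle: bunches at even and connections at odd places. -/
noncomputable def edgeDist {n : ℕ} [NeZero n] (b : Fin n → Bool → Bool → ℝ) (j : ℕ)
    (r r' : Bool) : ℝ :=
  if j % 2 = 0 then b (Fin.ofNat n (j / 2)) r r' else mmc b (Fin.ofNat n (j / 2 + 1)) r' r

/-- Marginal of a signed measure on joint states at the `j`-th edge of the cycle. -/
def edgeMeas {n : ℕ} [NeZero n] (y : (Fin n → Bool × Bool) → ℝ) (j : ℕ) (r r' : Bool) : ℝ :=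
  ∑ s, if vtx s j = r ∧ vtx s (j + 1) = r' then y s else 0

lemma mmc_nonneg {n : ℕ} {b : Fin n → Bool → Bool → ℝ} (hb : IsCyclicSystem n b) (i : Fin n)
    (r r' : Bool) : 0 ≤ mmc b i r r' := by
  have h := hb.1
  have hF : ∀ r, 0 ≤ mFst b i r := fun r => add_nonneg (h _ _ _) (h _ _ _)
  have hS : ∀ r, 0 ≤ mSnd b i r := fun r => add_nonneg (h _ _ _) (h _ _ _)
  cases r <;> cases r' <;> simp only [mmc]
  · exact le_min (hF _) (hS _)
  · exact sub_nonneg.2 (min_le_right _ _)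
  · exact sub_nonneg.2 (min_le_left _ _)
  · exact le_min (hF _) (hS _)

lemma mmc_marginals {n : ℕ} {b : Fin n → Bool → Bool → ℝ} (hb : IsCyclicSystem n b) (i : Fin n)
    (r : Bool) : mmc b i r false + mmc b i r true = mFst b i r ∧
      mmc b i false r + mmc b i true r = mSnd b i r := by
  have h1 := hb.2 i
  have h2 := hb.2 (fpred i)
  simp only [Fintype.sum_bool] at h1 h2
  have hF : mFst b i false = 1 - mFst b i true := by
    simp only [mFst]
    linarith
  have hS : mSnd b i false = 1 - mSnd b i true := by
    simp only [mSnd]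
    linarith
  cases r <;> simp only [mmc, hF, hS] <;>
    rcases le_total (mFst b i true) (mSnd b i true) with h | h
  · rw [min_eq_left h, min_eq_right (by linarith)]
    constructor <;> ring
  · rw [min_eq_right h, min_eq_left (by linarith)]
    constructor <;> ring
  all_goals constructor <;> ring

/-- Probability of the deviation from `π` at edge `k` that starts with the flip `a`. -/
def flipWeight (π : ℕ → Bool) (e : ℕ → Bool → Bool → ℝ) (k : ℕ) (a : Bool) : ℝ :=
  e k (xor a (π k)) (xor (!a) (π (k + 1)))

/-- The joint state that deviates from `π` at edge `k` only. -/
def oneFlip (n : ℕ) (π : ℕ → Bool) (k : ℕ) (a : Bool) : Fin n → Bool × Bool :=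
  ofVtx n fun x => xor (if x ≤ k then a else !a) (π x)

/-- The measure on states with a single deviation from `π` that reproduces the probabilities
of deviation prescribed by `e`. -/
def flipMeasure (n : ℕ) (π : ℕ → Bool) (e : ℕ → Bool → Bool → ℝ)
    (s : Fin n → Bool × Bool) : ℝ :=
  ∑ ω : Fin (2 * n) × Bool, if oneFlip n π ω.1 ω.2 = s then flipWeight π e ω.1 ω.2 else 0

lemma flipWeight_add (π : ℕ → Bool) (e : ℕ → Bool → Bool → ℝ) (k : ℕ) :
    flipWeight π e k true + flipWeight π e k false = edgeCost π e k := by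
  simp [flipWeight, edgeCost, add_comm]

lemma sum_flipMeasure {n : ℕ} (π : ℕ → Bool) (e : ℕ → Bool → Bool → ℝ) :
    ∑ s, flipMeasure n π e s = ∑ j ∈ range (2 * n), edgeCost π e j := by
  simp only [flipMeasure]
  rw [sum_comm]
  simp only [sum_ite_eq, mem_univ, if_true]
  rw [Fintype.sum_prod_type, sum_range]
  simp only [Fintype.sum_bool, flipWeight_add]

lemma flipMeasure_nonneg {n : ℕ} (π : ℕ → Bool) {e : ℕ → Bool → Bool → ℝ} (he : ∀ j r r', 0 ≤ e j r r')
    (s : Fin n → Bool × Bool) : 0 ≤ flipMeasure n π e s :=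
  sum_nonneg fun _ _ => by split_ifs; exacts [he _ _ _, le_rfl]

lemma flipMeasure_mono {n : ℕ} (π : ℕ → Bool) {e e' : ℕ → Bool → Bool → ℝ}
    (he : ∀ j r r', e j r r' ≤ e' j r r') (s : Fin n → Bool × Bool) :
    flipMeasure n π e s ≤ flipMeasure n π e' s :=
  sum_le_sum fun _ _ => by split_ifs; exacts [he _ _ _, le_rfl]

/-- Mass of the vertex event `q_x = c` under the single-deviation measure. -/
lemma sum_flipWeight_eq {n : ℕ} {π : ℕ → Bool} {T : ℝ} {e : ℕ → Bool → Bool → ℝ} (hc : Consistent T e)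
    (hper : edgeMarg e (2 * n) = edgeMarg e 0) (hπ : π (2 * n) = !π 0) {x : ℕ} (hx : x ≤ 2 * n)
    (c : Bool) :
    ∑ k ∈ range (2 * n), (if k < x then flipWeight π e k (!c) else flipWeight π e k c) =
      edgeMarg e x (xor c (π x)) - (T - ∑ j ∈ range (2 * n), edgeCost π e j) / 2 := by
  set V : ℕ → Bool → ℝ := fun x c =>
    ∑ k ∈ range (2 * n), (if k < x then flipWeight π e k (!c) else flipWeight π e k c) with hV
  have step : ∀ x < 2 * n, ∀ c, V (x + 1) c - V x c =
      edgeMarg e (x + 1) (xor c (π (x + 1))) - edgeMarg e x (xor c (π x)) := by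
    intro x hx c
    have h1 : V (x + 1) c - V x c = flipWeight π e x (!c) - flipWeight π e x c := by
      simp only [hV, ← sum_sub_distrib]
      rw [sum_eq_single x]
      · simp
      · intro k _ hk
        have : k < x + 1 ↔ k < x := by omega
        simp [this]
      · simp [hx]
    rw [h1, ← hc.1]
    simp only [edgeMarg, flipWeight]
    cases c <;> cases π x <;> cases π (x + 1) <;> simp <;> ring
  have const : ∀ x ≤ 2 * n, ∀ c, V x c - edgeMarg e x (xor c (π x)) =
      V 0 c - edgeMarg e 0 (xor c (π 0)) := by
    intro x hx c
    induction x with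
    | zero => rfl
    | succ x ih => linarith [step x hx c, ih (by omega)]
  have hend : ∀ c, V (2 * n) c = V 0 (!c) := by
    intro c
    refine sum_congr rfl fun k hk => ?_
    simp [mem_range.1 hk]
  have hsum : V 0 c + V 0 (!c) = ∑ j ∈ range (2 * n), edgeCost π e j := by
    simp only [hV, ← sum_add_distrib, ← flipWeight_add]
    refine sum_congr rfl fun k _ => ?_
    cases c <;> simp [add_comm]
  have hT : edgeMarg e 0 (xor c (π 0)) + edgeMarg e 0 (xor (!c) (π 0)) = T := by
    rw [← hc.2 0]
    cases c <;> cases π 0 <;> simp [add_comm]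
  have h1 := const _ le_rfl c
  have h2 := const x hx c
  have h3 : xor c (π (2 * n)) = xor (!c) (π 0) := by
    rw [hπ]
    simp
  rw [hend, hper, h3] at h1
  change V x c = _
  linarith

section

variable {n : ℕ} [NeZero n]

lemma vtx_two_mul (s : Fin n → Bool × Bool) (k : ℕ) :
    vtx s (2 * k) = (s (Fin.ofNat n k)).1 := by
  simp [vtx]

lemma vtx_two_mul_add_one (s : Fin n → Bool × Bool) (k : ℕ) :
    vtx s (2 * k + 1) = (s (Fin.ofNat n k)).2 := by
  have h : (2 * k + 1) / 2 = k := by omega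
  simp [vtx, h]

lemma edgeDist_two_mul (b : Fin n → Bool → Bool → ℝ) (k : ℕ) :
    edgeDist b (2 * k) = b (Fin.ofNat n k) := by
  funext r r'
  simp [edgeDist]

lemma edgeDist_two_mul_add_one (b : Fin n → Bool → Bool → ℝ) (k : ℕ) (r r' : Bool) :
    edgeDist b (2 * k + 1) r r' = mmc b (Fin.ofNat n (k + 1)) r' r := by
  have h : (2 * k + 1) / 2 = k := by omega
  simp [edgeDist, h]

lemma ofNat_add_self (k : ℕ) : Fin.ofNat n (k + n) = Fin.ofNat n k := by
  ext
  simp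

lemma vtx_periodic (s : Fin n → Bool × Bool) (x : ℕ) : vtx s (x + 2 * n) = vtx s x := by
  have h : (x + 2 * n) / 2 = x / 2 + n := by omega
  simp only [vtx, h, ofNat_add_self, Nat.add_mul_mod_self_left]

lemma edgeDist_periodic (b : Fin n → Bool → Bool → ℝ) (j : ℕ) :
    edgeDist b (j + 2 * n) = edgeDist b j := by
  have h : (j + 2 * n) / 2 = j / 2 + n := by omega
  have h' : j / 2 + n + 1 = j / 2 + 1 + n := by omega
  funext r r'
  simp only [edgeDist, h, h', ofNat_add_self, Nat.add_mul_mod_self_left]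

lemma vtx_ofVtx {t : ℕ → Bool} (ht : t (2 * n) = t 0) {x : ℕ} (hx : x ≤ 2 * n) :
    vtx (ofVtx n t) x = t x := by
  rcases hx.lt_or_eq with h | rfl
  · have h2 : x / 2 % n = x / 2 := Nat.mod_eq_of_lt (by omega)
    rcases Nat.mod_two_eq_zero_or_one x with h' | h' <;>
      simp only [vtx, ofVtx, h', Fin.val_ofNat, h2] <;> norm_num <;> congr 1 <;> omega
  · have := vtx_periodic (ofVtx n t) 0
    rw [zero_add] at this
    rw [this, ht]
    simp [vtx, ofVtx]

lemma fpred_ofNat_succ (k : ℕ) : fpred (Fin.ofNat n (k + 1)) = Fin.ofNat n k := by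
  have hn := NeZero.pos n
  have h : k + 1 + (n - 1) = k + n := by omega
  ext
  simp only [fpred, Fin.val_ofNat, Nat.mod_add_mod, h, Nat.add_mod_right]

lemma ofNat_fpred_succ (i : Fin n) : Fin.ofNat n ((fpred i).val + 1) = i := by
  have hn := NeZero.pos n
  have h : i.val + (n - 1) + 1 = i.val + n := by omega
  ext
  simp only [fpred, Fin.val_ofNat, Nat.mod_add_mod, h, Nat.add_mod_right, Nat.mod_eq_of_lt i.isLt]

lemma edgeMeas_two_mul (y : (Fin n → Bool × Bool) → ℝ) (k : ℕ) (r r' : Bool) :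
    edgeMeas y (2 * k) r r' = Bm (Fin.ofNat n k) y r r' := by
  simp only [edgeMeas, Bm, vtx_two_mul, vtx_two_mul_add_one, Prod.ext_iff]

lemma edgeMeas_two_mul_add_one (y : (Fin n → Bool × Bool) → ℝ) (k : ℕ) (r r' : Bool) :
    edgeMeas y (2 * k + 1) r r' = Cm (Fin.ofNat n (k + 1)) y r' r := by
  have h : 2 * k + 1 + 1 = 2 * (k + 1) := by ring
  simp only [edgeMeas, Cm, vtx_two_mul_add_one, h, vtx_two_mul, fpred_ofNat_succ, and_comm]

/-- Comparing bunch and connection marginals amounts to comparing all edges of the cycle. -/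
lemma forall_marginals_iff (R : ℝ → ℝ → Prop) (b : Fin n → Bool → Bool → ℝ)
    (y : (Fin n → Bool × Bool) → ℝ) :
    (∀ i r r', R (Bm i y r r') (b i r r') ∧ R (Cm i y r r') (mmc b i r r')) ↔
      ∀ j < 2 * n, ∀ r r', R (edgeMeas y j r r') (edgeDist b j r r') := by
  constructor
  · intro h j _ r r'
    rcases Nat.even_or_odd' j with ⟨k, rfl | rfl⟩
    · rw [edgeMeas_two_mul, edgeDist_two_mul]
      exact (h _ _ _).1
    · rw [edgeMeas_two_mul_add_one, edgeDist_two_mul_add_one]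
      exact (h _ _ _).2
  · intro h i r r'
    constructor
    · have := h (2 * i) (by omega) r r'
      rwa [edgeMeas_two_mul, edgeDist_two_mul, Fin.ofNat_val_eq_self] at this
    · have := h (2 * (fpred i).val + 1) (by omega) r' r
      rwa [edgeMeas_two_mul_add_one, edgeDist_two_mul_add_one, ofNat_fpred_succ] at this

lemma feasible_iff (b : Fin n → Bool → Bool → ℝ) (y : (Fin n → Bool × Bool) → ℝ) :
    Feasible b y ↔ ∀ j < 2 * n, ∀ r r', edgeMeas y j r r' = edgeDist b j r r' :=
  forall_marginals_iff (· = ·) b y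

lemma cntfConstraints_iff (b : Fin n → Bool → Bool → ℝ) (z : (Fin n → Bool × Bool) → ℝ) :
    CNTFConstraints b z ↔ (∀ s, 0 ≤ z s) ∧
      ∀ j < 2 * n, ∀ r r', edgeMeas z j r r' ≤ edgeDist b j r r' :=
  and_congr_right fun _ => forall_marginals_iff (· ≤ ·) b z

lemma edgeDist_nonneg {b : Fin n → Bool → Bool → ℝ} (hb : IsCyclicSystem n b) (j : ℕ)
    (r r' : Bool) : 0 ≤ edgeDist b j r r' := by
  unfold edgeDist
  split_ifs
  exacts [hb.1 _ _ _, mmc_nonneg hb _ _ _]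

lemma edgeDist_consistent {b : Fin n → Bool → Bool → ℝ} (hb : IsCyclicSystem n b) :
    Consistent 1 (edgeDist b) := by
  have tot : ∀ k, edgeMarg (edgeDist b) (2 * k) false + edgeMarg (edgeDist b) (2 * k) true
      = 1 := by
    intro k
    have := hb.2 (Fin.ofNat n k)
    simp only [Fintype.sum_bool] at this
    simp only [edgeMarg, edgeDist_two_mul]
    linarith
  have marg : ∀ j r, edgeDist b j false r + edgeDist b j true r =
      edgeMarg (edgeDist b) (j + 1) r := by
    intro j r
    rcases Nat.even_or_odd' j with ⟨k, rfl | rfl⟩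
    · simp only [edgeMarg, edgeDist_two_mul, edgeDist_two_mul_add_one]
      rw [(mmc_marginals hb _ _).2, mSnd, fpred_ofNat_succ]
    · have h : 2 * k + 1 + 1 = 2 * (k + 1) := by ring
      simp only [edgeMarg, h, edgeDist_two_mul, edgeDist_two_mul_add_one]
      exact (mmc_marginals hb _ _).1
  refine ⟨marg, fun j => ?_⟩
  rcases Nat.even_or_odd' j with ⟨k, rfl | rfl⟩
  · exact tot k
  · rw [← marg, ← marg, ← tot k]
    simp only [edgeMarg]
    ring

/-- Marginals of the image of a finite measure under a map to joint states. -/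
lemma edgeMeas_map {Ω : Type*} [Fintype Ω] (μ : Ω → ℝ) (S : Ω → Fin n → Bool × Bool) (j : ℕ)
    (r r' : Bool) :
    edgeMeas (fun s => ∑ ω, if S ω = s then μ ω else 0) j r r' =
      ∑ ω, if vtx (S ω) j = r ∧ vtx (S ω) (j + 1) = r' then μ ω else 0 := by
  simp only [edgeMeas, ite_sum_zero]
  rw [sum_comm]
  refine sum_congr rfl fun ω _ => ?_
  rw [sum_eq_single (S ω) (fun s _ hs => by simp [hs.symm]) (by simp)]
  simp

/-- A contextual system violates one of the noncontextuality inequalities. -/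
theorem exists_violated_pattern {b : Fin n → Bool → Bool → ℝ} (hb : IsCyclicSystem n b)
    (hctx : ¬ Noncontextual b) :
    ∃ π : ℕ → Bool, π (2 * n) = !π 0 ∧ ∑ j ∈ range (2 * n), edgeCost π (edgeDist b) j < 1 := by
  have he := edgeDist_nonneg hb
  have hc := edgeDist_consistent hb
  by_cases hlt : pathCost (edgeDist b) (2 * n) true < 1
  · obtain ⟨π, h0, hπ⟩ := exists_pattern_of_pathCost_lt_one he _ _ hlt
    refine ⟨π, ?_, hπ ▸ hlt⟩
    revert h0
    cases π 0 <;> cases π (2 * n) <;> simp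
  refine absurd ?_ hctx
  have hper : edgeMarg (edgeDist b) (2 * n) = edgeMarg (edgeDist b) 0 := by
    funext r
    have := edgeDist_periodic b 0
    rw [zero_add] at this
    simp only [edgeMarg, this]
  have hm : ∀ r, 0 ≤ edgeMarg (edgeDist b) 0 r := fun r => add_nonneg (he _ _ _) (he _ _ _)
  obtain ⟨Ω, _, μ, X, hμ, hX, h0⟩ := exists_path_coupling he hc (2 * n)
    (fun r r' => if r = r' then edgeMarg (edgeDist b) 0 r else 0)
    (fun r r' => by split_ifs; exacts [hm r, le_rfl])
    (fun r => by cases r <;> simp) (fun r => by rw [hper]; cases r <;> simp)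
    (by simpa using hlt) (by simpa using (pathCost_bounds he hc (2 * n)).1.1)
  have hzero : ∀ ω, X (2 * n) ω ≠ X 0 ω → μ ω = 0 := by
    intro ω hω
    have := h0 (X 0 ω) (X (2 * n) ω)
    rw [if_neg hω.symm, sum_eq_zero_iff_of_nonneg
      (fun ω' _ => by split_ifs; exacts [hμ ω', le_rfl])] at this
    simpa using this ω (mem_univ _)
  refine ⟨fun s => ∑ ω, if ofVtx n (fun x => X x ω) = s then μ ω else 0,
    (feasible_iff _ _).2 fun j hj r r' => ?_,
    fun s => sum_nonneg fun ω _ => by split_ifs; exacts [hμ ω, le_rfl]⟩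
  rw [edgeMeas_map, ← hX j hj]
  refine sum_congr rfl fun ω _ => ?_
  by_cases hω : X (2 * n) ω = X 0 ω
  · rw [vtx_ofVtx (by exact hω) hj.le, vtx_ofVtx (by exact hω) (Nat.succ_le_of_lt hj)]
  · simp [hzero ω hω]

lemma edgeMarg_edgeMeas (y : (Fin n → Bool × Bool) → ℝ) (j : ℕ) (r : Bool) :
    edgeMarg (edgeMeas y) j r = ∑ s, if vtx s j = r then y s else 0 := by
  simp only [edgeMarg, edgeMeas, ← sum_add_distrib]
  refine sum_congr rfl fun s _ => ?_
  cases vtx s (j + 1) <;> simp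

lemma edgeMeas_consistent (y : (Fin n → Bool × Bool) → ℝ) :
    Consistent (∑ s, y s) (edgeMeas y) := by
  refine ⟨fun j r => ?_, fun j => ?_⟩
  · rw [edgeMarg_edgeMeas]
    simp only [edgeMeas, ← sum_add_distrib]
    refine sum_congr rfl fun s _ => ?_
    cases vtx s j <;> simp
  · simp only [edgeMarg_edgeMeas, ← sum_add_distrib]
    refine sum_congr rfl fun s _ => ?_
    cases vtx s j <;> simp

lemma edgeMarg_edgeMeas_periodic (y : (Fin n → Bool × Bool) → ℝ) :
    edgeMarg (edgeMeas y) (2 * n) = edgeMarg (edgeMeas y) 0 := by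
  funext r
  have h := fun s : Fin n → Bool × Bool => vtx_periodic s 0
  simp only [zero_add] at h
  simp only [edgeMarg_edgeMeas, h]

lemma edgeMarg_edgeDist_periodic (b : Fin n → Bool → Bool → ℝ) :
    edgeMarg (edgeDist b) (2 * n) = edgeMarg (edgeDist b) 0 := by
  funext r
  have := edgeDist_periodic b 0
  rw [zero_add] at this
  simp only [edgeMarg, this]

lemma edgeMeas_sub_const_mul (y₁ y₂ : (Fin n → Bool × Bool) → ℝ) (c : ℝ) (j : ℕ) (r r' : Bool) :
    edgeMeas (fun s => y₁ s - c * y₂ s) j r r' = edgeMeas y₁ j r r' - c * edgeMeas y₂ j r r' := by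
  simp only [edgeMeas, mul_sum, ← sum_sub_distrib]
  refine sum_congr rfl fun s _ => ?_
  split_ifs <;> simp

/-- Number of edges at which a joint state deviates from the pattern `π`. -/
def deviations (π : ℕ → Bool) (s : Fin n → Bool × Bool) : ℕ :=
  #{j ∈ range (2 * n) | xor (vtx s j) (π j) ≠ xor (vtx s (j + 1)) (π (j + 1))}

lemma sum_edgeCost_edgeMeas (π : ℕ → Bool) (y : (Fin n → Bool × Bool) → ℝ) :
    ∑ j ∈ range (2 * n), edgeCost π (edgeMeas y) j = ∑ s, y s * deviations π s := by
  simp only [deviations, card_filter, Nat.cast_sum, mul_sum]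
  rw [sum_comm]
  refine sum_congr rfl fun j _ => ?_
  simp only [edgeCost, edgeMeas, ← sum_add_distrib]
  refine sum_congr rfl fun s _ => ?_
  cases vtx s j <;> cases vtx s (j + 1) <;> cases π j <;> cases π (j + 1) <;> simp

lemma one_le_deviations {π : ℕ → Bool} (hπ : π (2 * n) = !π 0) (s : Fin n → Bool × Bool) : 1 ≤ deviations π s := by
  by_contra! h
  rw [Nat.lt_one_iff, deviations, card_eq_zero, filter_eq_empty_iff] at h
  have key : ∀ x ≤ 2 * n, xor (vtx s x) (π x) = xor (vtx s 0) (π 0) := by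
    intro x hx
    induction x with
    | zero => rfl
    | succ x ih => rw [← ih (by omega), not_ne_iff.1 (h (mem_range.2 hx))]
  have h1 := key _ le_rfl
  have h2 := vtx_periodic s 0
  rw [zero_add] at h2
  simp [h2, hπ] at h1

lemma deviations_lt {π : ℕ → Bool} (hπ : π (2 * n) = !π 0) (s : Fin n → Bool × Bool) : deviations π s < 2 * n := by
  refine lt_of_le_of_ne ((card_filter_le _ _).trans_eq (card_range _)) fun h => ?_
  have h := (card_filter_eq_iff (s := range (2 * n))).1 (h.trans (card_range _).symm)
  have key : ∀ x ≤ n, xor (vtx s (2 * x)) (π (2 * x)) = xor (vtx s 0) (π 0) := by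
    intro x hx
    induction x with
    | zero => rfl
    | succ x ih =>
      have h1 := h (2 * x) (mem_range.2 (by omega))
      have h2 := h (2 * x + 1) (mem_range.2 (by omega))
      rw [← ih (by omega)]
      exact (Bool.eq_not.2 h2.symm).trans (Bool.eq_not.2 h1).symm
  have h1 := key _ le_rfl
  have h2 := vtx_periodic s 0
  rw [zero_add] at h2
  simp [h2, hπ] at h1

variable {π : ℕ → Bool}

/-- The single-deviation measure has the prescribed probabilities of deviation, and it splits
the remaining mass evenly among the other entries of every edge. -/
theorem edgeMeas_flipMeasure {T : ℝ} {e : ℕ → Bool → Bool → ℝ} (hc : Consistent T e)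
    (hper : edgeMarg e (2 * n) = edgeMarg e 0) (hπ : π (2 * n) = !π 0) {j : ℕ} (hj : j < 2 * n)
    (r r' : Bool) :
    edgeMeas (flipMeasure n π e) j r r' = e j r r' -
      if xor r (π j) = xor r' (π (j + 1)) then
        (T - ∑ j ∈ range (2 * n), edgeCost π e j) / 2 else 0 := by
  have hn := NeZero.pos n
  have hvtx : ∀ (k : Fin (2 * n)) (a : Bool) {x : ℕ}, x ≤ 2 * n →
      vtx (oneFlip n π k a) x = xor (if x ≤ k then a else !a) (π x) := by
    intro k a x hx
    refine vtx_ofVtx ?_ hx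
    simp [hπ, not_le.2 k.isLt]
  obtain ⟨c, rfl⟩ : ∃ c, r = xor c (π j) := ⟨xor r (π j), by simp⟩
  obtain ⟨c', rfl⟩ : ∃ c', r' = xor c' (π (j + 1)) := ⟨xor r' (π (j + 1)), by simp⟩
  have hsum : edgeMeas (flipMeasure n π e) j (xor c (π j)) (xor c' (π (j + 1))) =
      ∑ k ∈ range (2 * n), if c = c' then
        (if k < j then flipWeight π e k (!c) else flipWeight π e k c) -
          (if k = j then flipWeight π e k c else 0)
        else if k = j then flipWeight π e k c else 0 := by
    refine (edgeMeas_map _ _ _ _ _).trans ?_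
    rw [Fintype.sum_prod_type, sum_range]
    refine sum_congr rfl fun k _ => ?_
    simp only [hvtx _ _ hj.le, hvtx _ _ (Nat.succ_le_of_lt hj), Fintype.sum_bool]
    rcases lt_trichotomy k.val j with h | h | h
    · have h1 : ¬ j ≤ k := by omega
      have h2 : ¬ j + 1 ≤ k := by omega
      have h3 : k.val ≠ j := h.ne
      cases c <;> cases c' <;> simp [h, h1, h2, h3]
    · have h1 : ¬ j + 1 ≤ k := by omega
      cases c <;> cases c' <;> simp [h]
    · have h1 : ¬ k < j := by omega
      have h2 : j + 1 ≤ k := by omega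
      have h3 : k.val ≠ j := h.ne'
      cases c <;> cases c' <;> simp [h.le, h1, h2, h3]
  rw [hsum]
  simp only [Bool.xor_assoc, Bool.xor_self, Bool.xor_false]
  split_ifs with h
  · subst h
    rw [sum_sub_distrib, sum_flipWeight_eq hc hper hπ hj.le, sum_ite_eq', if_pos (mem_range.2 hj)]
    simp only [edgeMarg, flipWeight]
    cases c <;> cases π j <;> cases π (j + 1) <;> simp <;> ring
  · rw [sum_ite_eq', if_pos (mem_range.2 hj), flipWeight, Bool.eq_not.2 (Ne.symm h), sub_zero]

/-- The joint state that deviates from `π` at every edge but the last. -/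
def allFlip (n : ℕ) (π : ℕ → Bool) : Fin n → Bool × Bool :=
  ofVtx n fun x => xor (decide (x % 2 = 1 ∨ x = 2 * n)) (π x)

lemma vtx_allFlip (hπ : π (2 * n) = !π 0) {x : ℕ} (hx : x ≤ 2 * n) :
    vtx (allFlip n π) x = xor (decide (x % 2 = 1 ∨ x = 2 * n)) (π x) := by
  refine vtx_ofVtx ?_ hx
  simp [hπ, NeZero.ne n]

lemma deviations_allFlip (hπ : π (2 * n) = !π 0) : deviations π (allFlip n π) = 2 * n - 1 := by
  have hn := NeZero.pos n
  have : {j ∈ range (2 * n) | xor (vtx (allFlip n π) j) (π j) ≠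
      xor (vtx (allFlip n π) (j + 1)) (π (j + 1))} = range (2 * n - 1) := by
    ext j
    rw [mem_filter, mem_range, mem_range]
    by_cases hj : j < 2 * n
    · rw [vtx_allFlip hπ hj.le, vtx_allFlip hπ (Nat.succ_le_of_lt hj)]
      simp only [Bool.xor_assoc, Bool.xor_self, Bool.xor_false, ne_eq, decide_eq_decide]
      omega
    · omega
  rw [deviations, this, card_range]

lemma flipMeasure_allFlip (hn : 2 ≤ n) (hπ : π (2 * n) = !π 0) (e : ℕ → Bool → Bool → ℝ) :
    flipMeasure n π e (allFlip n π) = 0 := by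
  refine sum_eq_zero fun ω _ => if_neg fun h => ?_
  have key : ∀ x ≤ 2 * n, xor (if x ≤ ω.1 then ω.2 else !ω.2) (π x) =
      xor (decide (x % 2 = 1 ∨ x = 2 * n)) (π x) := by
    intro x hx
    rw [← vtx_allFlip hπ hx, ← h]
    refine (vtx_ofVtx (t := fun x => xor (if x ≤ ω.1 then ω.2 else !ω.2) (π x)) ?_ hx).symm
    simp [hπ, not_le.2 ω.1.isLt]
  have h0 := key 0 (by omega)
  have h1 := key 1 (by omega)
  have h2 := key 2 (by omega)
  have hn0 : n ≠ 0 := by omega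
  have hn1 : 2 ≠ 2 * n := by omega
  simp only [Bool.xor_left_inj] at h0 h1 h2
  have h0' : ω.2 = false := by simpa [hn0] using h0
  by_cases h3 : 1 ≤ ω.1.val
  · simp [h3, h0'] at h1
  · have h4 : ¬ 2 ≤ ω.1.val := by omega
    simp [h4, h0', hn1] at h2

/-- A violated pattern bounds the total variation of every quasi-coupling from below. -/
lemma one_add_le_sum_abs {b : Fin n → Bool → Bool → ℝ} (hb : IsCyclicSystem n b)
    (hπ : π (2 * n) = !π 0) {y : (Fin n → Bool × Bool) → ℝ} (hy : Feasible b y) :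
    (n - 1 : ℝ) + (1 - ∑ j ∈ range (2 * n), edgeCost π (edgeDist b) j) ≤
      (n - 1) * ∑ s, |y s| := by
  rw [feasible_iff] at hy
  have hn := NeZero.pos n
  have htot : ∑ s, y s = 1 := by
    rw [← (edgeMeas_consistent y).2 0, ← (edgeDist_consistent hb).2 0]
    simp only [edgeMarg, hy 0 (by omega)]
  have hcost : ∑ j ∈ range (2 * n), edgeCost π (edgeDist b) j = ∑ s, y s * deviations π s := by
    rw [← sum_edgeCost_edgeMeas]
    refine sum_congr rfl fun j hj => ?_
    simp only [edgeCost, hy j (mem_range.1 hj)]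
  have hpt : ∀ s, y s * n - y s * deviations π s ≤ (n - 1) * |y s| := by
    intro s
    have h1 : (1 : ℝ) ≤ deviations π s := by exact_mod_cast one_le_deviations hπ s
    have h2 : (deviations π s : ℝ) + 1 ≤ 2 * n := by exact_mod_cast deviations_lt hπ s
    have h3 : |(n : ℝ) - deviations π s| ≤ n - 1 := abs_le.2 ⟨by linarith, by linarith⟩
    calc y s * n - y s * deviations π s = (n - deviations π s) * y s := by ring
      _ ≤ |(n - deviations π s) * y s| := le_abs_self _
      _ = |(n : ℝ) - deviations π s| * |y s| := abs_mul _ _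
      _ ≤ _ := mul_le_mul_of_nonneg_right h3 (abs_nonneg _)
  have := sum_le_sum fun s (_ : s ∈ univ) => hpt s
  rw [sum_sub_distrib, ← sum_mul, htot, ← hcost, ← mul_sum] at this
  linarith

/-- The probabilities of deviating from a pattern bound the mass of every defective coupling. -/
lemma sum_le_sum_edgeCost {b : Fin n → Bool → Bool → ℝ} (hπ : π (2 * n) = !π 0)
    {z : (Fin n → Bool × Bool) → ℝ} (hz : CNTFConstraints b z) :
    ∑ s, z s ≤ ∑ j ∈ range (2 * n), edgeCost π (edgeDist b) j := by
  rw [cntfConstraints_iff] at hz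
  calc ∑ s, z s ≤ ∑ s, z s * deviations π s := sum_le_sum fun s _ =>
        le_mul_of_one_le_right (hz.1 s) (by exact_mod_cast one_le_deviations hπ s)
    _ = ∑ j ∈ range (2 * n), edgeCost π (edgeMeas z) j := (sum_edgeCost_edgeMeas π z).symm
    _ ≤ _ := sum_le_sum fun j hj =>
        add_le_add (hz.2 j (mem_range.1 hj) _ _) (hz.2 j (mem_range.1 hj) _ _)

end

/-- For a contextual cyclic system of rank `n ≥ 2`, there are an optimal quasi-coupling `y`
with a unique negative component at `v` (of value `-CNT3(b)/2`) and an optimal defective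
coupling `z` with `z ≤ |y|`, `z v = 0`, and `‖y - z‖₁ = n · CNT3(b)`. -/
theorem exists_equidistant_z (n : ℕ) (hn : 2 ≤ n)
    (b : Fin n → Bool → Bool → ℝ) (hb : IsCyclicSystem n b)
    (hctx : ¬ Noncontextual b) :
    ∃ (y z : (Fin n → Bool × Bool) → ℝ) (v : Fin n → Bool × Bool),
      Feasible b y ∧ (∑ s, |y s|) = 1 + CNT3 b ∧
      {s | y s < 0} = {v} ∧ y v = -(CNT3 b / 2) ∧
      CNTFConstraints b z ∧ (∑ s, z s) = 1 - CNTF b ∧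
      (∀ s, z s ≤ |y s|) ∧ z v = 0 ∧
      (∑ s, |y s - z s|) = (n : ℝ) * CNT3 b :=by
  have : NeZero n := ⟨by omega⟩
  obtain ⟨π, hπ, hlt⟩ := exists_violated_pattern hb hctx
  set D := 1 - ∑ j ∈ range (2 * n), edgeCost π (edgeDist b) j with hD
  have hn1 : (0 : ℝ) < n - 1 := by
    have : (2 : ℝ) ≤ n := by exact_mod_cast hn
    linarith
  obtain ⟨N, hN⟩ : ∃ N, D = 2 * (n - 1) * N := ⟨D / (2 * (n - 1)), by field_simp⟩
  have hDpos : 0 < D := by linarith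
  have hNpos : 0 < N := by
    by_contra! h
    nlinarith
  have he := edgeDist_nonneg hb
  have hc := edgeDist_consistent hb
  have hper := edgeMarg_edgeDist_periodic b
  set v := allFlip n π
  set δ : (Fin n → Bool × Bool) → ℝ := Pi.single v 1 with hδ
  have hδ0 : ∀ s, 0 ≤ δ s := fun s => by
    rw [hδ, Pi.single_apply]
    split_ifs <;> norm_num
  have hδ1 : ∑ s, δ s = 1 := by simp [hδ]
  have hδdev : ∑ j ∈ range (2 * n), edgeCost π (edgeMeas δ) j = 2 * n - 1 := by
    rw [sum_edgeCost_edgeMeas, sum_eq_single v (fun s _ hs => by simp [hδ, hs]) (by simp),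
      deviations_allFlip hπ, Nat.cast_sub (by omega)]
    simp [hδ]
  set e : ℕ → Bool → Bool → ℝ := fun j r r' => edgeDist b j r r' + N * edgeMeas δ j r r'
    with he_def
  have hle : ∀ j r r', edgeDist b j r r' ≤ e j r r' := fun j r r' =>
    le_add_of_nonneg_right (mul_nonneg hNpos.le
      (sum_nonneg fun s _ => by split_ifs; exacts [hδ0 s, le_rfl]))
  have hmarg : ∀ j r, edgeMarg e j r =
      edgeMarg (edgeDist b) j r + N * edgeMarg (edgeMeas δ) j r := fun j r => by
    simp only [edgeMarg, he_def]
    ring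
  have hec : Consistent (1 + N) e := by
    have hcδ := edgeMeas_consistent δ
    refine ⟨fun j r => ?_, fun j => ?_⟩
    · rw [hmarg, ← hc.1, ← hcδ.1]
      ring
    · rw [hmarg, hmarg]
      have h1 := hc.2 j
      have h2 := hcδ.2 j
      rw [hδ1] at h2
      linear_combination h1 + N * h2
  have heper : edgeMarg e (2 * n) = edgeMarg e 0 := by
    funext r
    rw [hmarg, hmarg, hper, edgeMarg_edgeMeas_periodic]
  have hecost : ∑ j ∈ range (2 * n), edgeCost π e j = 1 + N := by
    have : ∑ j ∈ range (2 * n), edgeCost π e j =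
        ∑ j ∈ range (2 * n), edgeCost π (edgeDist b) j +
          N * ∑ j ∈ range (2 * n), edgeCost π (edgeMeas δ) j := by
      rw [mul_sum, ← sum_add_distrib]
      refine sum_congr rfl fun j _ => ?_
      simp only [edgeCost, he_def]
      ring
    rw [this, hδdev]
    linarith
  set Y := flipMeasure n π e with hY
  set z := flipMeasure n π (edgeDist b) with hz
  have hz0 : ∀ s, 0 ≤ z s := flipMeasure_nonneg π he
  have hzY : ∀ s, z s ≤ Y s := flipMeasure_mono π hle
  have hYv : Y v = 0 := flipMeasure_allFlip hn hπ e
  have hzv : z v = 0 := flipMeasure_allFlip hn hπ _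
  have hYsum : ∑ s, Y s = 1 + N := by rw [hY, sum_flipMeasure, hecost]
  have hzsum : ∑ s, z s = 1 - D := by
    rw [hz, sum_flipMeasure]
    linarith
  have hyfeas : Feasible b fun s => Y s - N * δ s := by
    refine (feasible_iff _ _).2 fun j hj r r' => ?_
    rw [edgeMeas_sub_const_mul, edgeMeas_flipMeasure hec heper hπ hj, hecost]
    simp [he_def]
  have hδv : δ v = 1 := by simp [hδ]
  have hδne : ∀ s, s ≠ v → δ s = 0 := fun s hs => by simp [hδ, hs]
  have habs : ∀ s, |Y s - N * δ s| = Y s + N * δ s := by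
    intro s
    by_cases hs : s = v
    · rw [hs, hYv, hδv, zero_sub, abs_neg, mul_one, abs_of_pos hNpos, zero_add]
    · rw [hδne s hs, mul_zero, sub_zero, add_zero, abs_of_nonneg ((hz0 s).trans (hzY s))]
  have hysum : ∑ s, |Y s - N * δ s| = 1 + 2 * N := by
    simp only [habs, sum_add_distrib, ← mul_sum, hYsum, hδ1]
    ring
  have hzcon : CNTFConstraints b z := by
    refine (cntfConstraints_iff _ _).2 ⟨hz0, fun j hj r r' => ?_⟩
    rw [edgeMeas_flipMeasure hc hper hπ hj, ← hD]
    refine sub_le_self _ ?_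
    split_ifs
    exacts [by linarith, le_rfl]
  have hCNT3 : CNT3 b = 2 * N := by
    have : IsLeast {t : ℝ | ∃ y, Feasible b y ∧ t = ∑ s : Fin n → Bool × Bool, |y s|}
        (1 + 2 * N) := by
      refine ⟨⟨_, hyfeas, hysum.symm⟩, ?_⟩
      rintro _ ⟨y, hy, rfl⟩
      have := one_add_le_sum_abs hb hπ hy
      rw [← hD, hN] at this
      have h : (n - 1 : ℝ) * (1 + 2 * N) ≤ (n - 1) * ∑ s, |y s| := by linarith
      exact le_of_mul_le_mul_left h hn1
    rw [CNT3, this.csInf_eq]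
    ring
  have hCNTF : CNTF b = D := by
    have : IsGreatest {t : ℝ | ∃ z, CNTFConstraints b z ∧
        t = ∑ s : Fin n → Bool × Bool, z s} (1 - D) := by
      refine ⟨⟨_, hzcon, hzsum.symm⟩, ?_⟩
      rintro _ ⟨z', hz', rfl⟩
      rw [hD, sub_sub_cancel]
      exact sum_le_sum_edgeCost hπ hz'
    rw [CNTF, this.csSup_eq]
    ring
  rw [hCNT3, hCNTF]
  refine ⟨fun s => Y s - N * δ s, z, v, hyfeas, hysum, ?_, ?_, hzcon, hzsum, fun s => ?_, hzv, ?_⟩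
  · ext s
    change Y s - N * δ s < 0 ↔ s = v
    refine ⟨fun h => ?_, ?_⟩
    · by_contra hs
      rw [hδne s hs] at h
      linarith [hz0 s, hzY s]
    · rintro rfl
      rw [hYv, hδv]
      linarith
  · simp only [hYv, hδv]
    ring
  · rw [habs]
    linarith [hzY s, mul_nonneg hNpos.le (hδ0 s)]
  · have : ∀ s, |Y s - N * δ s - z s| = Y s + N * δ s - z s := by
      intro s
      by_cases hs : s = v
      · rw [hs, hzv, sub_zero, sub_zero, habs]
      · rw [hδne s hs, mul_zero, sub_zero, add_zero, abs_of_nonneg (sub_nonneg.2 (hzY s))]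
    simp only [this, sum_sub_distrib, sum_add_distrib, ← mul_sum, hYsum, hzsum, hδ1, hN]
    ring
end

section
/- For every cyclic system b of rank n ≥ 2, CNT3(b) ≥ 0, and CNT3(b) = 0 if and only if b is noncontextual (i.e., a solution of the quasi-coupling program is a true probability measure exactly when the system is noncontextual). -/
open Finset

/-- The sign character of `Bool`. -/
def boolSign (a : Bool) : ℝ := if a then 1 else -1

/-- Walsh characters are orthogonal. -/
theorem sum_prod_boolSign_mul_prod_boolSign {V : Type*} [Fintype V] [DecidableEq V]
    (S T : Finset V) :
    ∑ t : V → Bool, (∏ v ∈ S, boolSign (t v)) * ∏ v ∈ T, boolSign (t v) =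
      if S = T then (2 : ℝ) ^ Fintype.card V else 0 := by
  have h1 : ∀ t : V → Bool, (∏ v ∈ S, boolSign (t v)) * ∏ v ∈ T, boolSign (t v) =
      ∏ v, ((if v ∈ S then boolSign (t v) else 1) * (if v ∈ T then boolSign (t v) else 1)) := by
    intro t
    rw [prod_mul_distrib]
    simp
  have h2 := prod_univ_sum (fun _ : V => (univ : Finset Bool)) (fun v a =>
    (if v ∈ S then boolSign a else 1) * (if v ∈ T then boolSign a else 1))
  rw [Fintype.piFinset_univ] at h2
  simp_rw [h1]
  rw [← h2]
  have h3 : ∀ v, ∑ a : Bool, (if v ∈ S then boolSign a else 1) * (if v ∈ T then boolSign a else 1)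
      = if (v ∈ S ↔ v ∈ T) then (2 : ℝ) else 0 := by
    intro v
    by_cases hS : v ∈ S <;> by_cases hT : v ∈ T <;> norm_num [hS, hT, boolSign]
  simp_rw [h3]
  split_ifs with h
  · subst h
    simp
  · obtain ⟨v, hv⟩ : ∃ v, ¬(v ∈ S ↔ v ∈ T) := by
      by_contra! hc
      exact h (Finset.ext hc)
    exact prod_eq_zero (mem_univ v) (if_neg hv)

/-- The signed density whose Walsh coefficients are `c`. -/
noncomputable def walshDensity {V : Type*} [Fintype V] (c : Finset V → ℝ) (t : V → Bool) : ℝ :=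
  ((2 : ℝ) ^ Fintype.card V)⁻¹ * ∑ T : Finset V, c T * ∏ v ∈ T, boolSign (t v)

theorem sum_prod_boolSign_mul_walshDensity {V : Type*} [Fintype V] [DecidableEq V]
    (c : Finset V → ℝ) (S : Finset V) :
    ∑ t : V → Bool, (∏ v ∈ S, boolSign (t v)) * walshDensity c t = c S := by
  have h : ∀ t : V → Bool, (∏ v ∈ S, boolSign (t v)) * walshDensity c t =
      ∑ T : Finset V, ((2 : ℝ) ^ Fintype.card V)⁻¹ * c T *
        ((∏ v ∈ S, boolSign (t v)) * ∏ v ∈ T, boolSign (t v)) := by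
    intro t
    rw [walshDensity, mul_sum, mul_sum]
    exact sum_congr rfl fun T _ => by ring
  simp_rw [h]
  rw [sum_comm]
  simp_rw [← mul_sum, sum_prod_boolSign_mul_prod_boolSign]
  simp only [mul_ite, mul_zero, sum_ite_eq, mem_univ, if_true]
  field_simp

/-- The two-variable marginals of `walshDensity c` are read off from `c`. -/
theorem sum_ite_walshDensity {V : Type*} [Fintype V] [DecidableEq V]
    (c : Finset V → ℝ) {u w : V} (huw : u ≠ w) (r r' : Bool) :
    ∑ t : V → Bool, (if t u = r ∧ t w = r' then walshDensity c t else 0) =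
      (c ∅ + boolSign r * c {u} + boolSign r' * c {w}
        + boolSign r * boolSign r' * c {u, w}) / 4 := by
  have h : ∀ t : V → Bool, (if t u = r ∧ t w = r' then walshDensity c t else 0) =
      ((∏ v ∈ (∅ : Finset V), boolSign (t v)) * walshDensity c t
        + boolSign r * ((∏ v ∈ {u}, boolSign (t v)) * walshDensity c t)
        + boolSign r' * ((∏ v ∈ {w}, boolSign (t v)) * walshDensity c t)
        + boolSign r * boolSign r' *
          ((∏ v ∈ {u, w}, boolSign (t v)) * walshDensity c t)) / 4 := by
    intro t
    rw [prod_pair huw, prod_singleton, prod_singleton, prod_empty]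
    cases t u <;> cases t w <;> cases r <;> cases r' <;> simp [boolSign] <;> ring
  simp_rw [h]
  rw [← sum_div]
  simp only [sum_add_distrib, ← mul_sum, sum_prod_boolSign_mul_walshDensity]

/-- A table on `Bool × Bool` is determined by its Walsh coefficients. -/
theorem eq_walsh_expansion (p : Bool → Bool → ℝ) (r r' : Bool) :
    p r r' = ((p true true + p true false + p false true + p false false)
      + boolSign r * (p true true + p true false - p false true - p false false)
      + boolSign r' * (p true true + p false true - p true false - p false false)
      + boolSign r * boolSign r' *
        (p true true + p false false - p true false - p false true)) / 4 := by
  cases r <;> cases r' <;> simp [boolSign] <;> ring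

/-- Joint states of the bunches as sign assignments to the `2n` random variables. -/
def jointStateEquiv (n : ℕ) : (Fin n → Bool × Bool) ≃ (Fin n × Bool → Bool) where
  toFun s v := if v.2 then (s v.1).2 else (s v.1).1
  invFun t i := (t (i, false), t (i, true))
  left_inv s := by ext i <;> simp
  right_inv t := by
    ext ⟨i, a⟩
    cases a <;> simp

theorem fpred_ne_self {n : ℕ} (hn : 2 ≤ n) (i : Fin n) : fpred i ≠ i := by
  intro h
  have h1 : (i.val + (n - 1)) % n = i.val := congrArg Fin.val h
  have hi := i.isLt
  rcases Nat.eq_zero_or_pos i.val with h0 | h0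
  · rw [h0, Nat.mod_eq_of_lt (by omega)] at h1
    omega
  · rw [show i.val + (n - 1) = (i.val - 1) + n by omega, Nat.add_mod_right,
      Nat.mod_eq_of_lt (by omega)] at h1
    omega

/-- Walsh coefficients on the `2n`-cycle can be prescribed freely on the empty set,
the vertices and the edges. -/
theorem exists_walsh_coefficients {n : ℕ} (hn : 2 ≤ n) (m : Fin n × Bool → ℝ) (β γ : Fin n → ℝ) :
    ∃ c : Finset (Fin n × Bool) → ℝ, c ∅ = 1 ∧ (∀ v, c {v} = m v) ∧
      (∀ i, c {(i, false), (i, true)} = β i) ∧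
      ∀ i, c {(i, false), (fpred i, true)} = γ i := by
  have hmem : ∀ (i j k : Fin n), (({(i, false), (j, true)} : Finset (Fin n × Bool)) =
      {(k, false), (k, true)}) → i = k ∧ j = k := by
    intro i j k h
    have h1 : (i, false) ∈ ({(k, false), (k, true)} : Finset (Fin n × Bool)) := by simp [← h]
    have h2 : (j, true) ∈ ({(k, false), (k, true)} : Finset (Fin n × Bool)) := by simp [← h]
    simp at h1 h2
    exact ⟨h1, h2⟩
  have hmem' : ∀ (i j k l : Fin n), (({(i, false), (j, true)} : Finset (Fin n × Bool)) =
      {(k, false), (l, true)}) → i = k := by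
    intro i j k l h
    have h1 : (i, false) ∈ ({(k, false), (l, true)} : Finset (Fin n × Bool)) := by simp [← h]
    simpa using h1
  have hsing : ∀ (i j : Fin n) (v : Fin n × Bool),
      ({(i, false), (j, true)} : Finset (Fin n × Bool)) ≠ {v} := by
    intro i j v h
    have := congrArg Finset.card h
    rw [card_pair (by simp), card_singleton] at this
    omega
  have hempty : ∀ (i j : Fin n),
      ({(i, false), (j, true)} : Finset (Fin n × Bool)) ≠ ∅ := fun i j =>
    (insert_nonempty _ _).ne_empty
  refine ⟨fun T => (if T = ∅ then 1 else 0) + (∑ v, if T = {v} then m v else 0)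
    + (∑ i, if T = {(i, false), (i, true)} then β i else 0)
    + ∑ i, if T = {(i, false), (fpred i, true)} then γ i else 0, ?_, ?_, ?_, ?_⟩
  · simp [(hempty _ _).symm, (singleton_ne_empty _).symm]
  · intro v
    simp [(hsing _ _ _).symm]
  · intro i
    have hB : ∀ j, (({(i, false), (i, true)} : Finset (Fin n × Bool)) =
        {(j, false), (j, true)}) ↔ i = j :=
      fun j => ⟨fun h => (hmem _ _ _ h).1, fun h => by rw [h]⟩
    have hC : ∀ j, ({(i, false), (i, true)} : Finset (Fin n × Bool)) ≠
        {(j, false), (fpred j, true)} := fun j h => by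
      have := hmem _ _ _ h.symm
      exact fpred_ne_self hn j (this.2.trans this.1.symm)
    simp only [hempty, hsing, hB, hC, if_false]
    simp
  · intro i
    have hC : ∀ j, (({(i, false), (fpred i, true)} : Finset (Fin n × Bool)) =
        {(j, false), (fpred j, true)}) ↔ i = j :=
      fun j => ⟨fun h => hmem' _ _ _ _ h, fun h => by rw [h]⟩
    have hB : ∀ j, ({(i, false), (fpred i, true)} : Finset (Fin n × Bool)) ≠
        {(j, false), (j, true)} := fun j h => by
      have := hmem _ _ _ h
      exact fpred_ne_self hn i (this.2.trans this.1.symm)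
    simp only [hempty, hsing, hB, hC, if_false]
    simp

theorem exists_feasible {n : ℕ} (hn : 2 ≤ n) {b : Fin n → Bool → Bool → ℝ}
    (hb : IsCyclicSystem n b) : ∃ y, Feasible b y := by
  obtain ⟨c, h0, h1, hB, hC⟩ := exists_walsh_coefficients hn
    (fun v => if v.2 then b v.1 true true + b v.1 false true - b v.1 true false - b v.1 false false
      else b v.1 true true + b v.1 true false - b v.1 false true - b v.1 false false)
    (fun i => b i true true + b i false false - b i true false - b i false true)
    (fun i => mmc b i true true + mmc b i false false - mmc b i true false - mmc b i false true)
  have hsum : ∀ i, b i true true + b i true false + b i false true + b i false false = 1 := by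
    intro i
    have := hb.2 i
    simp only [Fintype.sum_bool] at this
    linarith
  refine ⟨fun s => walshDensity c (jointStateEquiv n s), fun i r r' => ⟨?_, ?_⟩⟩
  · have h : Bm i (fun s => walshDensity c (jointStateEquiv n s)) r r' =
        ∑ t, if t (i, false) = r ∧ t (i, true) = r' then walshDensity c t else 0 := by
      rw [← (jointStateEquiv n).sum_comp]
      simp [Bm, jointStateEquiv, Prod.ext_iff]
    rw [h, sum_ite_walshDensity c (by simp), h0, h1, h1, hB, eq_walsh_expansion (b i) r r', hsum]
    simp
  · have h : Cm i (fun s => walshDensity c (jointStateEquiv n s)) r r' =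
        ∑ t, if t (i, false) = r ∧ t (fpred i, true) = r' then walshDensity c t else 0 := by
      rw [← (jointStateEquiv n).sum_comp]
      simp [Cm, jointStateEquiv]
    rw [h, sum_ite_walshDensity c (by simp), h0, h1, h1, hC, eq_walsh_expansion (mmc b i) r r']
    have hi := hsum i
    have hp := hsum (fpred i)
    have hmin : mmc b i false false = 1 - mFst b i true - mSnd b i true + mmc b i true true := by
      simp only [mmc, mFst, mSnd]
      rcases le_total (b i true false + b i true true)
        (b (fpred i) false true + b (fpred i) true true) with hle | hle
      · rw [min_eq_left hle, min_eq_right (by linarith)]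
        linarith
      · rw [min_eq_right hle, min_eq_left (by linarith)]
        linarith
    have htf : mmc b i true false = mFst b i true - mmc b i true true := rfl
    have hft : mmc b i false true = mSnd b i true - mmc b i true true := rfl
    rw [hmin, htf, hft]
    simp only [mFst, mSnd, if_true, Bool.false_eq_true, if_false]
    linear_combination boolSign r * (-hi) / 4 + boolSign r' * (-hp) / 4

theorem Feasible.sum_eq_one {n : ℕ} (hn : 0 < n) {b : Fin n → Bool → Bool → ℝ}
    (hb : IsCyclicSystem n b) {y : (Fin n → Bool × Bool) → ℝ} (hy : Feasible b y) :
    ∑ s, y s = 1 := by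
  rw [← hb.2 ⟨0, hn⟩]
  simp_rw [← fun r r' => (hy ⟨0, hn⟩ r r').1, Bm, Fintype.sum_bool, ← sum_add_distrib]
  refine sum_congr rfl fun s _ => ?_
  rcases s ⟨0, hn⟩ with ⟨_ | _, _ | _⟩ <;> simp

theorem isClosed_setOf_feasible {n : ℕ} (b : Fin n → Bool → Bool → ℝ) :
    IsClosed {y | Feasible b y} := by
  simp only [Feasible, Set.ofPred_forall, Set.ofPred_and]
  refine isClosed_iInter fun i => isClosed_iInter fun r => isClosed_iInter fun r' =>
    IsClosed.inter (isClosed_eq ?_ continuous_const) (isClosed_eq ?_ continuous_const)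
  · refine continuous_finsetSum _ fun s _ => ?_
    split_ifs <;> fun_prop
  · refine continuous_finsetSum _ fun s _ => ?_
    split_ifs <;> fun_prop

/-- The total variation attains its minimum on a nonempty closed set. -/
theorem IsClosed.exists_sum_abs_le {ι : Type*} [Fintype ι] {K : Set (ι → ℝ)} (hK : IsClosed K)
    (hne : K.Nonempty) : ∃ y ∈ K, ∀ z ∈ K, ∑ s, |y s| ≤ ∑ s, |z s| := by
  obtain ⟨y₀, hy₀⟩ := hne
  have hle : ∀ y : ι → ℝ, ‖y‖ ≤ ∑ s, |y s| := fun y =>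
    (pi_norm_le_iff_of_nonneg (sum_nonneg fun _ _ => abs_nonneg _)).2 fun s =>
      single_le_sum (f := fun s => |y s|) (fun _ _ => abs_nonneg _) (mem_univ s)
  have htend : Filter.Tendsto (fun y : ι → ℝ => ∑ s, |y s|) (Filter.cocompact _) Filter.atTop :=
    Filter.tendsto_atTop_mono hle (tendsto_norm_cocompact_atTop (E := ι → ℝ))
  have hcont : Continuous fun y : ι → ℝ => ∑ s, |y s| := by fun_prop
  obtain ⟨y, hyK, hy⟩ := hcont.continuousOn.exists_isMinOn' hK hy₀
    ((htend.eventually_ge_atTop _).filter_mono inf_le_left)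
  exact ⟨y, hyK, fun z hz => hy hz⟩

/-- For every cyclic system of rank `n ≥ 2`, `CNT3(b) ≥ 0`, with equality
iff the system is noncontextual. -/
theorem cnt3_nonneg_and_eq_zero_iff (n : ℕ) (hn : 2 ≤ n)
    (b : Fin n → Bool → Bool → ℝ) (hb : IsCyclicSystem n b) :
    0 ≤ CNT3 b ∧ (CNT3 b = 0 ↔ Noncontextual b) := by
  obtain ⟨y, hy, hmin⟩ := (isClosed_setOf_feasible b).exists_sum_abs_le (exists_feasible hn hb)
  have hleast : IsLeast {t : ℝ | ∃ y, Feasible b y ∧ t = ∑ s : Fin n → Bool × Bool, |y s|}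
      (∑ s, |y s|) := by
    refine ⟨⟨y, hy, rfl⟩, ?_⟩
    rintro _ ⟨z, hz, rfl⟩
    exact hmin z hz
  have hone : ∑ s, y s = 1 := Feasible.sum_eq_one (by omega) hb hy
  have hle : ∑ s, y s ≤ ∑ s, |y s| := sum_le_sum fun s _ => le_abs_self _
  have hcnt : CNT3 b = ∑ s, |y s| - 1 := by rw [CNT3, hleast.csInf_eq]
  rw [hcnt]
  refine ⟨by linarith, fun h => ⟨y, hy, fun s => ?_⟩, ?_⟩
  · have heq := (sum_eq_sum_iff_of_le fun s _ => le_abs_self (y s)).1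
      (by linarith : ∑ s, y s = ∑ s, |y s|)
    exact abs_eq_self.1 (heq s (mem_univ s)).symm
  · rintro ⟨z, hz, hz0⟩
    have hz1 : ∑ s, |z s| = 1 := by
      simp_rw [abs_of_nonneg (hz0 _)]
      exact Feasible.sum_eq_one (by omega) hb hz
    have := hmin z hz
    linarith
end

section
/- For every cyclic system b of rank n ≥ 2, the 4n + 1 linear functionals on the space of signed quasi-couplings y : (Fin n → Bool × Bool) → ℝ given by: y ↦ Bm i y true true for each i ∈ Fin n, y ↦ Cm i y true true for each i ∈ Fin n, y ↦ ∑_{s : (s i).1 = true} y s for each i ∈ Fin n, y ↦ ∑_{s : (s i).2 = true} y s for each i ∈ Fin n, and y ↦ ∑_s y s, are linearly independent. -/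
open Finset

/-- The `4n + 1` row functionals of the reduced incidence matrix `M`:
bunch probabilities `Pr(1,1)` per context, connection probabilities `Pr(1,1)` per content,
the two single-variable probabilities `Pr(·=1)` per context, and the total mass. -/
noncomputable def rowFunctional (n : ℕ) :
    (Fin n ⊕ Fin n ⊕ Fin n ⊕ Fin n ⊕ Unit) → ((Fin n → Bool × Bool) → ℝ) → ℝ
  | Sum.inl i => fun y => Bm i y true true
  | Sum.inr (Sum.inl i) => fun y => Cm i y true true
  | Sum.inr (Sum.inr (Sum.inl i)) => fun y =>
      ∑ s : Fin n → Bool × Bool, if (s i).1 = true then y s else 0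
  | Sum.inr (Sum.inr (Sum.inr (Sum.inl i))) => fun y =>
      ∑ s : Fin n → Bool × Bool, if (s i).2 = true then y s else 0
  | Sum.inr (Sum.inr (Sum.inr (Sum.inr _))) => fun y => ∑ s : Fin n → Bool × Bool, y s

/-- A linear relation between the row functionals, evaluated at a single joint state. -/
theorem rowFunctional_relation_apply {n : ℕ} {g : Fin n ⊕ Fin n ⊕ Fin n ⊕ Fin n ⊕ Unit → ℝ}
    (hg : ∑ k, g k • rowFunctional n k = 0) (p q : Fin n → Prop)
    [DecidablePred p] [DecidablePred q] :
    (∑ i, if p i ∧ q i then g (.inl i) else 0) +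
      ((∑ i, if p i ∧ q (fpred i) then g (.inr (.inl i)) else 0) +
      ((∑ i, if p i then g (.inr (.inr (.inl i))) else 0) +
      ((∑ i, if q i then g (.inr (.inr (.inr (.inl i)))) else 0) +
        g (.inr (.inr (.inr (.inr ()))))))) = 0 := by
  let s : Fin n → Bool × Bool := fun i => (decide (p i), decide (q i))
  have single_sum (P : (Fin n → Bool × Bool) → Prop) [DecidablePred P] :
      (∑ t, if P t then (Pi.single s 1 : (Fin n → Bool × Bool) → ℝ) t else 0) =
        if P s then 1 else 0 := by
    rw [Finset.sum_eq_single s (fun t _ ht => by simp [ht]) (by simp)]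
    simp
  have h := congrFun hg (Pi.single s 1)
  simpa [rowFunctional, Bm, Cm, single_sum, s] using h

/-- For every cyclic system of rank `n ≥ 2`, the `4n + 1` row functionals of the
reduced incidence matrix are linearly independent. -/
theorem rowFunctionals_linearIndependent (n : ℕ) (hn : 2 ≤ n)
    (b : Fin n → Bool → Bool → ℝ) (hb : IsCyclicSystem n b) :
    LinearIndependent ℝ (rowFunctional n) := by
  rw [Fintype.linearIndependent_iff]
  intro g hg
  have rel (p q : Fin n → Prop) [DecidablePred p] [DecidablePred q] :=
    rowFunctional_relation_apply hg p q
  have hU : g (.inr (.inr (.inr (.inr ())))) = 0 := by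
    simpa using rel (fun _ => False) (fun _ => False)
  have hF (i : Fin n) : g (.inr (.inr (.inl i))) = 0 := by
    simpa [hU] using rel (fun j => j = i) (fun _ => False)
  have hS (i : Fin n) : g (.inr (.inr (.inr (.inl i)))) = 0 := by
    simpa [hU] using rel (fun _ => False) (fun j => j = i)
  have hB (i : Fin n) : g (.inl i) = 0 := by
    simpa [hU, hF, hS, ite_and, fpred_ne_self hn] using rel (fun j => j = i) (fun j => j = i)
  have hC (i : Fin n) : g (.inr (.inl i)) = 0 := by
    simpa [hU, hF, hS, hB, ite_and] using rel (fun j => j = i) (fun j => j = fpred i)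
  rintro (i | i | i | i | _)
  exacts [hB i, hC i, hF i, hS i, hU]
end

section
/- For every cyclic system b of rank n ≥ 2, the multimaximal-coupling distribution c i has the correct marginals: for all i ∈ Fin n and r, r' ∈ Bool, ∑_{r'} c i r r' = mFst i r and ∑_r c i r r' = mSnd i r'. Consequently the consistified system b‡ (of rank 2n, with b‡ (2i) = b i and b‡ (2i+1) r r' = c (i⊕1) r' r) is consistently connected: for each of its contents, the marginal distributions of its two measurements coincide. -/
open Finset

/-- The consistification of a cyclic system of rank `n`: a cyclic system of rank `2n`
whose even-indexed bunches are the original bunches and whose odd-indexed bunch `2i+1`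
is the joint distribution of the multimaximal coupling `(T_{i⊕1}^i, T_{i⊕1}^{i⊕1})`
of connection `i⊕1`. -/
noncomputable def consistify (n : ℕ) (b : Fin n → Bool → Bool → ℝ) :
    Fin (2 * n) → Bool → Bool → ℝ :=
  fun j r r' =>
    if j.val % 2 = 0 then b ⟨j.val / 2, by have := j.isLt; omega⟩ r r'
    else mmc b (fsucc ⟨j.val / 2, by have := j.isLt; omega⟩) r' r

theorem fpred_fsucc {n : ℕ} (i : Fin n) : fpred (fsucc i) = i := by
  have hi := i.isLt
  apply Fin.ext
  simp only [fpred, fsucc, Nat.mod_add_mod]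
  rw [show i.val + 1 + (n - 1) = i.val + n by omega, Nat.add_mod_right, Nat.mod_eq_of_lt hi]

theorem fsucc_fpred {n : ℕ} (i : Fin n) : fsucc (fpred i) = i := by
  have hi := i.isLt
  apply Fin.ext
  simp only [fpred, fsucc, Nat.mod_add_mod]
  rw [show i.val + (n - 1) + 1 = i.val + n by omega, Nat.add_mod_right, Nat.mod_eq_of_lt hi]

theorem val_fpred {n : ℕ} (i : Fin n) :
    (fpred i).val = if i.val = 0 then n - 1 else i.val - 1 := by
  have hi := i.isLt
  simp only [fpred]
  split_ifs with h
  · rw [h, zero_add, Nat.mod_eq_of_lt (by omega)]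
  · rw [show i.val + (n - 1) = i.val - 1 + n by omega, Nat.add_mod_right,
      Nat.mod_eq_of_lt (by omega)]

theorem mFst_add {n : ℕ} {b : Fin n → Bool → Bool → ℝ} (hb : IsCyclicSystem n b) (i : Fin n) :
    mFst b i false + mFst b i true = 1 := by
  have h := hb.2 i
  simp only [Fintype.sum_bool] at h
  simp only [mFst]
  linarith

theorem mSnd_add {n : ℕ} {b : Fin n → Bool → Bool → ℝ} (hb : IsCyclicSystem n b) (i : Fin n) :
    mSnd b i false + mSnd b i true = 1 := by
  have h := hb.2 (fpred i)
  simp only [Fintype.sum_bool] at h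
  simp only [mSnd]
  linarith

/-- The diagonal entries of the coupling, in terms of each other. -/
theorem min_marginals_false {n : ℕ} {b : Fin n → Bool → Bool → ℝ} (hb : IsCyclicSystem n b)
    (i : Fin n) :
    min (mFst b i false) (mSnd b i false) =
      1 - mFst b i true - mSnd b i true + min (mFst b i true) (mSnd b i true) := by
  have h₁ := mFst_add hb i
  have h₂ := mSnd_add hb i
  rcases le_total (mFst b i true) (mSnd b i true) with h | h
  · rw [min_eq_left h, min_eq_right (by linarith)]
    linarith
  · rw [min_eq_right h, min_eq_left (by linarith)]
    linarith

theorem sum_mmc_right {n : ℕ} {b : Fin n → Bool → Bool → ℝ} (hb : IsCyclicSystem n b)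
    (i : Fin n) (r : Bool) : (∑ r' : Bool, mmc b i r r') = mFst b i r := by
  have h₁ := mFst_add hb i
  have h := min_marginals_false hb i
  cases r <;> simp only [Fintype.sum_bool, mmc] <;> linarith

theorem sum_mmc_left {n : ℕ} {b : Fin n → Bool → Bool → ℝ} (hb : IsCyclicSystem n b)
    (i : Fin n) (r' : Bool) : (∑ r : Bool, mmc b i r r') = mSnd b i r' := by
  have h₂ := mSnd_add hb i
  have h := min_marginals_false hb i
  cases r' <;> simp only [Fintype.sum_bool, mmc] <;> linarith

theorem consistify_of_val_eq_two_mul {n : ℕ} (b : Fin n → Bool → Bool → ℝ) {j : Fin (2 * n)}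
    {i : Fin n} (h : j.val = 2 * i.val) : consistify n b j = b i := by
  have hi : (⟨j.val / 2, by have := j.isLt; omega⟩ : Fin n) = i :=
    Fin.ext (by simp only; omega)
  funext r r'
  rw [consistify, if_pos (by omega), hi]

theorem consistify_of_val_eq_two_mul_add_one {n : ℕ} (b : Fin n → Bool → Bool → ℝ)
    {j : Fin (2 * n)} {i : Fin n} (h : j.val = 2 * i.val + 1) (r r' : Bool) :
    consistify n b j r r' = mmc b (fsucc i) r' r := by
  have hi : (⟨j.val / 2, by have := j.isLt; omega⟩ : Fin n) = i :=
    Fin.ext (by simp only; omega)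
  rw [consistify, if_neg (by omega), hi]

theorem mFst_consistify_eq_mSnd {n : ℕ} {b : Fin n → Bool → Bool → ℝ}
    (hb : IsCyclicSystem n b) (j : Fin (2 * n)) (r : Bool) :
    mFst (consistify n b) j r = mSnd (consistify n b) j r := by
  have hj := j.isLt
  have hp := val_fpred j
  let i : Fin n := ⟨j.val / 2, by omega⟩
  have hi : i.val = j.val / 2 := rfl
  rcases Nat.mod_two_eq_zero_or_one j.val with h | h
  · have hq := val_fpred i
    have hpred : (fpred j).val = 2 * (fpred i).val + 1 := by
      split_ifs at hp hq <;> omega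
    have hs := sum_mmc_right hb i r
    rw [Fintype.sum_bool] at hs
    rw [mSnd, consistify_of_val_eq_two_mul_add_one b hpred,
      consistify_of_val_eq_two_mul_add_one b hpred, fsucc_fpred, add_comm, hs, mFst, mFst,
      consistify_of_val_eq_two_mul b (i := i) (by omega)]
  · have hpred : (fpred j).val = 2 * i.val := by
      split_ifs at hp <;> omega
    have hodd : j.val = 2 * i.val + 1 := by omega
    have hs := sum_mmc_left hb (fsucc i) r
    rw [Fintype.sum_bool] at hs
    rw [mFst, consistify_of_val_eq_two_mul_add_one b hodd,
      consistify_of_val_eq_two_mul_add_one b hodd, add_comm, hs, mSnd, mSnd, fpred_fsucc,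
      consistify_of_val_eq_two_mul b hpred]

/-- The multimaximal-coupling distribution of each connection has the correct marginals,
and consequently the consistified system is consistently connected. -/
theorem mmc_marginals_and_consistified_consistent (n : ℕ) (hn : 2 ≤ n)
    (b : Fin n → Bool → Bool → ℝ) (hb : IsCyclicSystem n b) :
    (∀ i r, (∑ r' : Bool, mmc b i r r') = mFst b i r) ∧
    (∀ i r', (∑ r : Bool, mmc b i r r') = mSnd b i r') ∧
    (∀ j : Fin (2 * n), ∀ r, mFst (consistify n b) j r = mSnd (consistify n b) j r) := by
  exact ⟨sum_mmc_right hb, sum_mmc_left hb, mFst_consistify_eq_mSnd hb⟩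
end

section
/- Let n = 3 and let b be the cyclic system of rank 3 in which every bunch has the distribution b i r r' = 1/8 if r = r' and 3/8 if r ≠ r' (so each bunch has Pr(0,0) = Pr(1,1) = 1/8 and Pr(0,1) = Pr(1,0) = 3/8). This system is consistently connected, and CNT3(b) = 1/8 and CNTF(b) = 1/4, so that CNTF(b) = (3 − 1) · CNT3(b). -/
open Finset

/-- The consistently connected rank-3 cyclic system of Example 1: every bunch has
`Pr(0,0) = Pr(1,1) = 1/8` and `Pr(0,1) = Pr(1,0) = 3/8`. -/
noncomputable def bEx : Fin 3 → Bool → Bool → ℝ :=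
  fun _ r r' => if r = r' then 1/8 else 3/8

/-- Number of bunches of `s` whose two values agree. -/
def equalBunches (s : Fin 3 → Bool × Bool) : ℕ :=
  #{i : Fin 3 | (s i).1 = (s i).2}

/-- Number of connections of `s` whose two values differ. -/
def unequalConnections (s : Fin 3 → Bool × Bool) : ℕ :=
  #{i : Fin 3 | (s i).1 ≠ (s (fpred i)).2}

/-- An optimal signed quasi-coupling of `bEx`, scaled by `96`. -/
def optimalCoupling (s : Fin 3 → Bool × Bool) : ℤ :=
  if equalBunches s = 1 ∧ unequalConnections s = 0 then 14
  else if equalBunches s = 0 ∧ unequalConnections s = 1 then 3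
  else if equalBunches s = 2 ∧ unequalConnections s = 3 then -1
  else 0

/-- An optimal solution of the contextual-fraction program of `bEx`, scaled by `8`. -/
def optimalSubcoupling (s : Fin 3 → Bool × Bool) : ℤ :=
  if equalBunches s = 1 ∧ unequalConnections s = 0 then 1 else 0

lemma optimalCoupling_Bm (i : Fin 3) (r r' : Bool) :
    (∑ s, if s i = (r, r') then optimalCoupling s else 0) = if r = r' then 12 else 36 := by
  revert i r r'
  decide +kernel

lemma optimalCoupling_Cm (i : Fin 3) (r r' : Bool) :
    (∑ s, if (s i).1 = r ∧ (s (fpred i)).2 = r' then optimalCoupling s else 0) =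
      if r = r' then 48 else 0 := by
  revert i r r'
  decide +kernel

lemma optimalCoupling_sum_abs : ∑ s, |optimalCoupling s| = 108 := by
  decide +kernel

lemma optimalSubcoupling_nonneg (s : Fin 3 → Bool × Bool) : 0 ≤ optimalSubcoupling s := by
  unfold optimalSubcoupling
  split_ifs <;> norm_num

lemma optimalSubcoupling_Bm (i : Fin 3) (r r' : Bool) :
    (∑ s, if s i = (r, r') then optimalSubcoupling s else 0) ≤ if r = r' then 1 else 3 := by
  revert i r r'
  decide +kernel

lemma optimalSubcoupling_Cm (i : Fin 3) (r r' : Bool) :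
    (∑ s, if (s i).1 = r ∧ (s (fpred i)).2 = r' then optimalSubcoupling s else 0) ≤
      if r = r' then 4 else 0 := by
  revert i r r'
  decide +kernel

lemma optimalSubcoupling_sum : ∑ s, optimalSubcoupling s = 6 := by
  decide +kernel

lemma Bm_intCast_div {n : ℕ} (i : Fin n) (f : (Fin n → Bool × Bool) → ℤ) (c : ℝ) (r r' : Bool) :
    Bm i (fun s => (f s : ℝ) / c) r r' =
      ((∑ s, if s i = (r, r') then f s else 0 : ℤ) : ℝ) / c := by
  simp only [Bm, Int.cast_sum, Finset.sum_div]
  refine Finset.sum_congr rfl fun s _ => ?_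
  split_ifs <;> simp

lemma Cm_intCast_div {n : ℕ} (i : Fin n) (f : (Fin n → Bool × Bool) → ℤ) (c : ℝ) (r r' : Bool) :
    Cm i (fun s => (f s : ℝ) / c) r r' =
      ((∑ s, if (s i).1 = r ∧ (s (fpred i)).2 = r' then f s else 0 : ℤ) : ℝ) / c := by
  simp only [Cm, Int.cast_sum, Finset.sum_div]
  refine Finset.sum_congr rfl fun s _ => ?_
  split_ifs <;> simp

lemma mmc_bEx (i : Fin 3) (r r' : Bool) : mmc bEx i r r' = if r = r' then 1 / 2 else 0 := by
  cases r <;> cases r' <;> norm_num [mmc, mFst, mSnd, bEx]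

lemma fpred_three : fpred (0 : Fin 3) = 2 ∧ fpred (1 : Fin 3) = 0 ∧ fpred (2 : Fin 3) = 1 := by
  decide

lemma feasible_optimalCoupling : Feasible bEx fun s => (optimalCoupling s : ℝ) / 96 := by
  intro i r r'
  rw [Bm_intCast_div, Cm_intCast_div, optimalCoupling_Bm, optimalCoupling_Cm, mmc_bEx, bEx]
  split_ifs <;> norm_num

lemma cntfConstraints_optimalSubcoupling :
    CNTFConstraints bEx fun s => (optimalSubcoupling s : ℝ) / 8 := by
  refine ⟨fun s => div_nonneg (mod_cast optimalSubcoupling_nonneg s) (by norm_num),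
    fun i r r' => ?_⟩
  rw [Bm_intCast_div, Cm_intCast_div, mmc_bEx, bEx, div_le_iff₀ (by norm_num),
    div_le_iff₀ (by norm_num)]
  have hB : ((∑ s, if s i = (r, r') then optimalSubcoupling s else 0 : ℤ) : ℝ) ≤
      ((if r = r' then 1 else 3 : ℤ) : ℝ) := mod_cast optimalSubcoupling_Bm i r r'
  have hC : ((∑ s, if (s i).1 = r ∧ (s (fpred i)).2 = r' then optimalSubcoupling s else 0 : ℤ) :
      ℝ) ≤ ((if r = r' then 4 else 0 : ℤ) : ℝ) := mod_cast optimalSubcoupling_Cm i r r'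
  refine ⟨hB.trans ?_, hC.trans ?_⟩ <;> split_ifs <;> norm_num

/-- The cyclic inequality for signed quasi-couplings of rank 3. -/
lemma cyclic_sum_le_sum_abs (y : (Fin 3 → Bool × Bool) → ℝ) :
    ∑ i, (Cm i y true true + Cm i y false false - Cm i y true false - Cm i y false true
      - Bm i y true true - Bm i y false false + Bm i y true false + Bm i y false true) ≤
      4 * ∑ s, |y s| := by
  simp only [Bm, Cm, ← Finset.sum_add_distrib, ← Finset.sum_sub_distrib]
  rw [Finset.sum_comm, Finset.mul_sum]
  refine Finset.sum_le_sum fun s _ => ?_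
  have h₁ := neg_abs_le (y s)
  have h₂ := le_abs_self (y s)
  obtain ⟨e₀, e₁, e₂⟩ := fpred_three
  rw [Fin.sum_univ_three, e₀, e₁, e₂]
  generalize y s = t at *
  rcases s 0 with ⟨_ | _, _ | _⟩ <;> rcases s 1 with ⟨_ | _, _ | _⟩ <;>
    rcases s 2 with ⟨_ | _, _ | _⟩ <;> simp <;> linarith

/-- In rank 3, every joint state has an equal bunch or an unequal connection. -/
lemma sum_le_cyclic_sum {z : (Fin 3 → Bool × Bool) → ℝ} (hz : ∀ s, 0 ≤ z s) :
    ∑ s, z s ≤ ∑ i, (Bm i z true true + Bm i z false false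
      + Cm i z true false + Cm i z false true) := by
  simp only [Bm, Cm, ← Finset.sum_add_distrib]
  rw [Finset.sum_comm]
  refine Finset.sum_le_sum fun s _ => ?_
  have h := hz s
  obtain ⟨e₀, e₁, e₂⟩ := fpred_three
  rw [Fin.sum_univ_three, e₀, e₁, e₂]
  generalize z s = t at *
  rcases s 0 with ⟨_ | _, _ | _⟩ <;> rcases s 1 with ⟨_ | _, _ | _⟩ <;>
    rcases s 2 with ⟨_ | _, _ | _⟩ <;> simp <;> linarith

lemma isLeast_sum_abs_feasible :
    IsLeast {t : ℝ | ∃ y, Feasible bEx y ∧ t = ∑ s : Fin 3 → Bool × Bool, |y s|} (9 / 8) := by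
  refine ⟨⟨_, feasible_optimalCoupling, ?_⟩, ?_⟩
  · have h : ((∑ s, |optimalCoupling s| : ℤ) : ℝ) = 108 := mod_cast optimalCoupling_sum_abs
    push_cast at h
    simp only [abs_div, ← Finset.sum_div, h]
    norm_num
  · rintro _ ⟨y, hy, rfl⟩
    have h := cyclic_sum_le_sum_abs y
    simp only [(hy _ _ _).1, (hy _ _ _).2, mmc_bEx, bEx, Fin.sum_univ_three] at h
    norm_num at h
    linarith

lemma isGreatest_sum_cntfConstraints :
    IsGreatest {t : ℝ | ∃ z, CNTFConstraints bEx z ∧ t = ∑ s : Fin 3 → Bool × Bool, z s}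
      (3 / 4) := by
  refine ⟨⟨_, cntfConstraints_optimalSubcoupling, ?_⟩, ?_⟩
  · have h : ((∑ s, optimalSubcoupling s : ℤ) : ℝ) = 6 := mod_cast optimalSubcoupling_sum
    push_cast at h
    rw [← Finset.sum_div, h]
    norm_num
  · rintro _ ⟨z, ⟨hz, hb⟩, rfl⟩
    refine (sum_le_cyclic_sum hz).trans ((Finset.sum_le_sum fun i _ =>
      add_le_add (add_le_add (add_le_add (hb i true true).1 (hb i false false).1)
        (hb i true false).2) (hb i false true).2).trans ?_)
    norm_num [mmc_bEx, bEx]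

/-- The system `bEx` is a consistently connected cyclic system of rank 3 with
`CNT3 = 1/8` and `CNTF = 1/4 = (3 - 1) · CNT3`. -/
theorem example_consistently_connected :
    IsCyclicSystem 3 bEx ∧
    (∀ i r, mFst bEx i r = mSnd bEx i r) ∧
    CNT3 bEx = 1/8 ∧ CNTF bEx = 1/4 ∧
    CNTF bEx = ((3 : ℝ) - 1) * CNT3 bEx := by
  have h₃ : CNT3 bEx = 1 / 8 := by
    rw [CNT3, isLeast_sum_abs_feasible.csInf_eq]
    norm_num
  have hF : CNTF bEx = 1 / 4 := by
    rw [CNTF, isGreatest_sum_cntfConstraints.csSup_eq]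
    norm_num
  refine ⟨⟨fun i r r' => ?_, fun i => ?_⟩, fun i r => ?_, h₃, hF, ?_⟩
  · rw [bEx]
    split_ifs <;> norm_num
  · norm_num [bEx]
  · cases r <;> norm_num [mFst, mSnd, bEx]
  · rw [h₃, hF]
    norm_num
end
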